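/- arXiv:2308.15782 — 6 statements merged into one kernel-verified Lean document; each statement's English description precedes it below -/
import Mathlib

section
/- For every fixed integer s ≥ 1, the s-th moment of the normalized number of correct guesses converges: E((X_n/√n)^s) = (1/(2^n·n^{s/2}))·Σ_{k≥0} k^s·[q^k] f_n(q) → μ̃_s as n → ∞. -/
/-- The polynomials `g_{m1,m2}(q)` defined by the recurrence
`g_{m1,m2}(q) = q^{δ(c,m1)} g_{m1-1,m2}(q) + g_{m1,m2-1}(q)` with `c = ⌊(m1+m2)/2⌋+1`,
`g_{0,0} = 1` and `g` vanishing for negative indices. -/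
noncomputable def gP : ℕ → ℕ → Polynomial ℝ
  | 0, 0 => 1
  | 0, m2 + 1 => gP 0 m2
  | m1 + 1, 0 =>
      Polynomial.X ^ (if (m1 + 1) / 2 + 1 = m1 + 1 then 1 else 0) * gP m1 0
  | m1 + 1, m2 + 1 =>
      Polynomial.X ^ (if (m1 + 1 + (m2 + 1)) / 2 + 1 = m1 + 1 then 1 else 0) * gP m1 (m2 + 1)
        + gP (m1 + 1) m2

/-- `P(t) = (1 - √(1-4t))/2`, the generating function of shifted Catalan numbers. -/
noncomputable def Pgf (t : ℝ) : ℝ := (1 - Real.sqrt (1 - 4 * t)) / 2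

/-- The generating function `f_n(q)` of the number of correct guesses `X_n`:
`P(X_n = k) = [q^k] f_n(q) / 2^n`, with `h = ⌈n/2⌉`. -/
noncomputable def fP (n : ℕ) : Polynomial ℝ :=
  4 * Polynomial.X ^ 4 - 2 * (Polynomial.X ^ 2 + Polynomial.X ^ 3) +
    ∑ a ∈ Finset.range ((n + 1) / 2 + 1), ∑ b ∈ Finset.range (n - (n + 1) / 2 + 1),
      gP a ((n + 1) / 2 - a) * gP b (n - (n + 1) / 2 - b)

/-- The moments `μ̃_s` of the sum of two independent half-normal random variables. -/
noncomputable def mutilde (s : ℕ) : ℝ :=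
  ∑ k ∈ Finset.range (s + 1),
    (s.choose k : ℝ) * Real.Gamma (((k : ℝ) + 1) / 2) * Real.Gamma (((s : ℝ) - (k : ℝ) + 1) / 2)
      / Real.pi

open Filter

/-- The ballot number `C(b+i, b) - C(b+i, b+1)`. -/
noncomputable def ballot (b i : ℕ) : ℝ := ((b + i).choose b : ℝ) - ((b + i).choose (b + 1) : ℝ)

theorem ballot_zero (b : ℕ) : ballot b 0 = 1 := by simp [ballot]

theorem ballot_succ_self (b : ℕ) : ballot b (b + 1) = 0 := by
  have h := Nat.choose_symm_half b
  rw [ballot, show b + (b + 1) = 2 * b + 1 by ring, h, sub_self]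

theorem ballot_succ_succ (b i : ℕ) :
    ballot (b + 1) (i + 1) = ballot b (i + 1) + ballot (b + 1) i := by
  simp only [ballot]
  rw [show b + 1 + (i + 1) = (b + i + 1) + 1 by ring, show b + (i + 1) = b + i + 1 by ring,
    show b + 1 + i = b + i + 1 by ring, Nat.choose_succ_succ (b + i + 1) b,
    Nat.choose_succ_succ (b + i + 1) (b + 1)]
  push_cast
  ring

/-- Convolution of a sequence of polynomials with the ballot numbers `ballot b`. -/
noncomputable def ballotConv (c : ℕ → Polynomial ℝ) (b n : ℕ) : Polynomial ℝ :=
  ∑ j ∈ Finset.range (n + 1), Polynomial.C (ballot b (n - j)) * c j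

theorem ballotConv_zero (c : ℕ → Polynomial ℝ) (b : ℕ) : ballotConv c b 0 = c 0 := by
  simp [ballotConv, ballot_zero]

theorem ballotConv_succ_succ (c : ℕ → Polynomial ℝ) (b n : ℕ) :
    ballotConv c (b + 1) (n + 1) = ballotConv c b (n + 1) + ballotConv c (b + 1) n := by
  simp only [ballotConv]
  rw [Finset.sum_range_succ, Finset.sum_range_succ _ (n + 1)]
  simp only [Nat.sub_self, ballot_zero]
  rw [add_right_comm, ← Finset.sum_add_distrib]
  congr 1
  refine Finset.sum_congr rfl fun j hj => ?_
  have hj' : n + 1 - j = (n - j) + 1 := by have := Finset.mem_range.1 hj; omega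
  rw [hj', ballot_succ_succ, Polynomial.C_add, add_mul]

/-- The weights `1, X, 2 X², 4 X³, …`. -/
noncomputable def lowerWeight : ℕ → Polynomial ℝ
  | 0 => 1
  | j + 1 => 2 ^ j * Polynomial.X ^ (j + 1)

/-- The weights `X, 2 X², 4 X³, …`. -/
noncomputable def upperWeight (j : ℕ) : Polynomial ℝ := 2 ^ j * Polynomial.X ^ (j + 1)

theorem ballotConv_lowerWeight_succ (b n : ℕ) :
    ballotConv lowerWeight b (n + 1) =
      ballotConv upperWeight b n + Polynomial.C (ballot b (n + 1)) := by
  simp only [ballotConv]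
  rw [Finset.sum_range_succ']
  simp [lowerWeight, upperWeight]

theorem X_mul_ballotConv_lowerWeight (b : ℕ) :
    Polynomial.X * ballotConv lowerWeight (b + 1) (b + 1)
      + Polynomial.X * ballotConv upperWeight (b + 1) b = ballotConv upperWeight (b + 1) (b + 1) := by
  rw [ballotConv_lowerWeight_succ]
  simp only [ballotConv]
  rw [Finset.sum_range_succ' _ (b + 1)]
  have : ∑ k ∈ Finset.range (b + 1),
      Polynomial.C (ballot (b + 1) (b + 1 - (k + 1))) * upperWeight (k + 1)
      = 2 * (Polynomial.X * ∑ k ∈ Finset.range (b + 1),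
        Polynomial.C (ballot (b + 1) (b - k)) * upperWeight k) := by
    rw [Finset.mul_sum, Finset.mul_sum]
    refine Finset.sum_congr rfl fun j _ => ?_
    simp only [upperWeight, Nat.add_sub_add_right]
    ring
  rw [this]
  simp [upperWeight]
  ring

theorem gP_closed (m : ℕ) : ∀ a b : ℕ, a + b = m →
    (a ≤ b → gP a b = ballotConv lowerWeight b a) ∧
    (a = b + 1 → gP a b = ballotConv upperWeight b b) ∧
    (b + 2 ≤ a → gP a b = Polynomial.X * ballotConv upperWeight (a - 1) b) := by
  induction m with
  | zero =>
    intro a b h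
    obtain ⟨rfl, rfl⟩ : a = 0 ∧ b = 0 := by omega
    refine ⟨fun _ => ?_, by omega, by omega⟩
    rw [ballotConv_zero, gP, lowerWeight]
  | succ m ih =>
    intro a b h
    rcases a with _ | a
    · rcases b with _ | b
      · omega
      refine ⟨fun _ => ?_, by omega, by omega⟩
      rw [gP, ((ih 0 b) (by omega)).1 (by omega), ballotConv_zero, ballotConv_zero]
    rcases b with _ | b
    · obtain ⟨h1, h2, h3⟩ := ih a 0 (by omega)
      refine ⟨by omega, fun ha => ?_, fun ha => ?_⟩
      · obtain rfl : a = 0 := by omega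
        rw [gP, h1 le_rfl, ballotConv_zero, ballotConv_zero]
        simp [upperWeight, lowerWeight]
      · rw [gP]
        rcases Nat.lt_or_ge a 2 with ha2 | ha2
        · obtain rfl : a = 1 := by omega
          rw [h2 rfl, ballotConv_zero, ballotConv_zero]
          simp
        · rw [if_neg (by omega), h3 (by omega), ballotConv_zero, ballotConv_zero]
          simp
    obtain ⟨h1, h2, h3⟩ := ih a (b + 1) (by omega)
    obtain ⟨k1, k2, k3⟩ := ih (a + 1) b (by omega)
    refine ⟨fun ha => ?_, fun ha => ?_, fun ha => ?_⟩
    · rw [gP, if_neg (by omega), h1 (by omega), pow_zero, one_mul]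
      rcases Nat.lt_or_ge a b with hab | hab
      · rw [k1 (by omega), ballotConv_succ_succ, add_comm]
      · obtain rfl : a = b := by omega
        rw [k2 (by omega), ballotConv_succ_succ, add_comm, ballotConv_lowerWeight_succ,
          ballot_succ_self, Polynomial.C_0, add_zero]
    · obtain rfl : a = b + 1 := by omega
      rw [gP, if_pos (by omega), h1 (by omega), pow_one, k3 (by omega), ← X_mul_ballotConv_lowerWeight]
      simp
    · rw [gP]
      rcases Nat.lt_or_ge a (b + 3) with hab | hab
      · obtain rfl : a = b + 2 := by omega
        rw [if_pos (by omega), h2 (by omega), k3 (by omega), pow_one, ← mul_add]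
        simp only [Nat.add_sub_cancel]
        rw [← ballotConv_succ_succ]
      · rw [if_neg (by omega), h3 (by omega), k3 (by omega), pow_zero, one_mul, ← mul_add]
        obtain ⟨d, rfl⟩ : ∃ d, a = d + 1 := ⟨a - 1, by omega⟩
        simp only [Nat.add_sub_cancel]
        rw [← ballotConv_succ_succ]

theorem ballotConv_eq_sum_range (c : ℕ → Polynomial ℝ) {b n m : ℕ} (h : b + n = m) :
    ballotConv c b n = ∑ j ∈ Finset.range (m + 1),
      Polynomial.C (((m - j).choose b : ℝ) - ((m - j).choose (b + 1) : ℝ)) * c j := by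
  have hsub : Finset.range (n + 1) ⊆ Finset.range (m + 1) :=
    Finset.range_subset_range.2 (by omega)
  rw [← Finset.sum_subset hsub, ballotConv]
  · refine Finset.sum_congr rfl fun j hj => ?_
    have : b + (n - j) = m - j := by have := Finset.mem_range.1 hj; omega
    rw [ballot, this]
  · intro j hj hj'
    rw [Finset.mem_range] at hj hj'
    rw [Nat.choose_eq_zero_of_lt (by omega), Nat.choose_eq_zero_of_lt (by omega)]
    simp

/-- The numbers `2^j C(m-j, ⌈m/2⌉)`. -/
noncomputable def returnWeight (m j : ℕ) : ℝ := 2 ^ j * ((m - j).choose ((m + 1) / 2) : ℝ)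

/-- The generating polynomial of `returnWeight m`. -/
noncomputable def returnPoly (m : ℕ) : Polynomial ℝ :=
  ∑ j ∈ Finset.range (m + 1), Polynomial.C (returnWeight m j) * Polynomial.X ^ j

/-- The generating polynomial of the number of correct guesses in a pile of `m` cards. -/
noncomputable def guessPoly (m : ℕ) : Polynomial ℝ := ∑ a ∈ Finset.range (m + 1), gP a (m - a)

theorem guessPoly_eq_sum_add_sum {m p : ℕ} (hp : p ≤ m) :
    guessPoly m = ∑ a ∈ Finset.range (p + 1), gP a (m - a) + ∑ b ∈ Finset.range (m - p), gP (m - b) b := by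
  rw [guessPoly, show m + 1 = (p + 1) + (m - p) by omega, Finset.sum_range_add]
  congr 1
  rw [← Finset.sum_range_reflect]
  refine Finset.sum_congr rfl fun j hj => ?_
  have := Finset.mem_range.1 hj
  rw [show p + 1 + (m - p - 1 - j) = m - j by omega, show m - (m - j) = j by omega]

theorem two_mul_sum_gP_lower (m : ℕ) :
    2 * ∑ a ∈ Finset.range (m / 2 + 1), gP a (m - a) =
      returnPoly m + Polynomial.C (returnWeight m 0) := by
  have h1 : ∀ a ∈ Finset.range (m / 2 + 1), gP a (m - a) = ∑ j ∈ Finset.range (m + 1),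
      Polynomial.C (((m - j).choose (m + 1 - (a + 1)) : ℝ) - ((m - j).choose (m + 1 - a) : ℝ))
        * lowerWeight j := by
    intro a ha
    have := Finset.mem_range.1 ha
    rw [(gP_closed m a (m - a) (by omega)).1 (by omega),
      ballotConv_eq_sum_range _ (show m - a + a = m by omega)]
    rw [show m + 1 - (a + 1) = m - a by omega, show m + 1 - a = m - a + 1 by omega]
  rw [Finset.sum_congr rfl h1, Finset.sum_comm]
  have h2 : ∀ j ∈ Finset.range (m + 1), ∑ a ∈ Finset.range (m / 2 + 1),
      Polynomial.C (((m - j).choose (m + 1 - (a + 1)) : ℝ) - ((m - j).choose (m + 1 - a) : ℝ))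
        * lowerWeight j = Polynomial.C ((m - j).choose ((m + 1) / 2) : ℝ) * lowerWeight j := by
    intro j _
    rw [← Finset.sum_mul, ← map_sum,
      Finset.sum_range_sub (fun a => ((m - j).choose (m + 1 - a) : ℝ)),
      show m + 1 - (m / 2 + 1) = (m + 1) / 2 by omega, Nat.choose_eq_zero_of_lt (k := m + 1 - 0) (by omega)]
    simp
  rw [Finset.sum_congr rfl h2, returnPoly, Finset.sum_range_succ', Finset.sum_range_succ' _ m, mul_add,
    Finset.mul_sum, add_assoc]
  congr 1
  · refine Finset.sum_congr rfl fun j _ => ?_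
    simp only [lowerWeight, returnWeight, map_mul, map_pow, Polynomial.C_ofNat]
    ring
  · simp [lowerWeight, returnWeight]
    ring

theorem two_mul_sum_gP_upper (m : ℕ) :
    2 * ∑ b ∈ Finset.range (m / 2), gP (m - b) b =
      Polynomial.X * (returnPoly m - Polynomial.C (returnWeight m 0)) := by
  rcases m with _ | m
  · simp [returnPoly]
  have h1 : ∀ b ∈ Finset.range ((m + 1) / 2), gP (m + 1 - b) b =
      ∑ j ∈ Finset.range (m + 1), Polynomial.C (((m - j).choose (m + 1 - (b + 1)) : ℝ)
        - ((m - j).choose (m + 1 - b) : ℝ)) * (Polynomial.X * upperWeight j) := by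
    intro b hb
    have := Finset.mem_range.1 hb
    rw [(gP_closed (m + 1) (m + 1 - b) b (by omega)).2.2 (by omega),
      ballotConv_eq_sum_range _ (show m + 1 - b - 1 + b = m by omega), Finset.mul_sum]
    rw [show m + 1 - (b + 1) = m + 1 - b - 1 by omega, show m + 1 - b - 1 + 1 = m + 1 - b by omega]
    exact Finset.sum_congr rfl fun j _ => by ring
  rw [Finset.sum_congr rfl h1, Finset.sum_comm]
  have h2 : ∀ j ∈ Finset.range (m + 1), ∑ b ∈ Finset.range ((m + 1) / 2),
      Polynomial.C (((m - j).choose (m + 1 - (b + 1)) : ℝ) - ((m - j).choose (m + 1 - b) : ℝ))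
        * (Polynomial.X * upperWeight j)
      = Polynomial.C ((m - j).choose ((m + 1 + 1) / 2) : ℝ) * (Polynomial.X * upperWeight j) := by
    intro j _
    rw [← Finset.sum_mul, ← map_sum,
      Finset.sum_range_sub (fun b => ((m - j).choose (m + 1 - b) : ℝ)),
      show m + 1 - (m + 1) / 2 = (m + 1 + 1) / 2 by omega,
      Nat.choose_eq_zero_of_lt (k := m + 1 - 0) (by omega)]
    simp
  rw [Finset.sum_congr rfl h2, returnPoly, Finset.sum_range_succ' _ (m + 1), pow_zero, mul_one,
    add_sub_cancel_right,
    Finset.mul_sum, Finset.mul_sum]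
  refine Finset.sum_congr rfl fun j _ => ?_
  simp only [upperWeight, returnWeight, map_mul, map_pow, Polynomial.C_ofNat, Nat.add_sub_add_right]
  ring

theorem gP_succ_self (p : ℕ) :
    gP (p + 1) p = (Polynomial.X - 1) * returnPoly (2 * p + 1)
      + Polynomial.C (returnWeight (2 * p + 1) 0) := by
  rw [(gP_closed (2 * p + 1) (p + 1) p (by omega)).2.1 rfl,
    ballotConv_eq_sum_range _ (show p + p = 2 * p by omega)]
  have h1 : ∀ j ∈ Finset.range (2 * p + 1),
      Polynomial.C (((2 * p - j).choose p : ℝ) - ((2 * p - j).choose (p + 1) : ℝ)) * upperWeight j =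
        Polynomial.X * (Polynomial.C (returnWeight (2 * p + 1) j) * Polynomial.X ^ j)
        - Polynomial.C (returnWeight (2 * p + 1) (j + 1)) * Polynomial.X ^ (j + 1) := by
    intro j hj
    have := Finset.mem_range.1 hj
    simp only [upperWeight, returnWeight]
    rw [show (2 * p + 1 + 1) / 2 = p + 1 by omega, show 2 * p + 1 - (j + 1) = 2 * p - j by omega,
      show 2 * p + 1 - j = (2 * p - j) + 1 by omega, Nat.choose_succ_succ]
    simp only [map_mul, map_pow, Polynomial.C_ofNat, map_sub, Nat.cast_add, map_add]
    ring
  rw [Finset.sum_congr rfl h1, Finset.sum_sub_distrib, ← Finset.mul_sum, sub_mul, one_mul]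
  have h2 : returnPoly (2 * p + 1) = ∑ j ∈ Finset.range (2 * p + 1),
      Polynomial.C (returnWeight (2 * p + 1) j) * Polynomial.X ^ j := by
    rw [returnPoly, Finset.sum_range_succ, add_eq_left]
    simp [returnWeight, show (2 * p + 1 + 1) / 2 = p + 1 by omega]
  have h3 : returnPoly (2 * p + 1) = ∑ j ∈ Finset.range (2 * p + 1),
      Polynomial.C (returnWeight (2 * p + 1) (j + 1)) * Polynomial.X ^ (j + 1)
      + Polynomial.C (returnWeight (2 * p + 1) 0) := by
    rw [returnPoly, Finset.sum_range_succ', pow_zero, mul_one]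
  rw [← h2]
  linear_combination h3

theorem two_mul_guessPoly (m : ℕ) :
    2 * guessPoly m = returnPoly m + Polynomial.C (returnWeight m 0)
      + Polynomial.X * (returnPoly m - Polynomial.C (returnWeight m 0))
      + 2 * Polynomial.C ((m % 2 : ℕ) : ℝ) *
        ((Polynomial.X - 1) * returnPoly m + Polynomial.C (returnWeight m 0)) := by
  rw [guessPoly_eq_sum_add_sum (Nat.div_le_self m 2), mul_add, two_mul_sum_gP_lower,
    ← two_mul_sum_gP_upper]
  rcases Nat.even_or_odd' m with ⟨p, rfl | rfl⟩
  · rw [show 2 * p - 2 * p / 2 = 2 * p / 2 by omega, Nat.mul_mod_right]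
    simp
  · rw [show 2 * p + 1 - (2 * p + 1) / 2 = p + 1 by omega, Finset.sum_range_succ,
      show (2 * p + 1) / 2 = p by omega, show (2 * p + 1) % 2 = 1 by omega,
      show 2 * p + 1 - p = p + 1 by omega, gP_succ_self]
    simp
    ring

theorem guessPoly_eval_one (m : ℕ) : (guessPoly m).eval 1 = 2 ^ m := by
  have key : ∀ m a b : ℕ, a + b = m → (gP a b).eval 1 = ((a + b).choose a : ℝ) := by
    intro m
    induction m with
    | zero =>
      intro a b h
      obtain ⟨rfl, rfl⟩ : a = 0 ∧ b = 0 := by omega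
      simp [gP]
    | succ m ih =>
      intro a b h
      rcases a with _ | a <;> rcases b with _ | b
      · omega
      · rw [gP, ih _ _ (by omega)]; simp
      · rw [gP, Polynomial.eval_mul, Polynomial.eval_pow, ih _ _ (by omega)]; simp [-pow_ite]
      · rw [gP, Polynomial.eval_add, Polynomial.eval_mul, Polynomial.eval_pow, ih _ _ (by omega), ih _ _ (by omega),
          show a + 1 + (b + 1) = (a + b + 1) + 1 by ring, show a + (b + 1) = a + b + 1 by ring,
          show a + 1 + b = a + b + 1 by ring, Nat.choose_succ_succ (a + b + 1) a]
        simp [-pow_ite]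
  rw [guessPoly, Polynomial.eval_finsetSum, ← Nat.cast_two, ← Nat.cast_pow, ← Nat.sum_range_choose,
    Nat.cast_sum]
  refine Finset.sum_congr rfl fun a ha => ?_
  have := Finset.mem_range.1 ha
  rw [key m a (m - a) (by omega), show a + (m - a) = m by omega]

/-- The linear functional `Σ c_k X^k ↦ Σ c_k k^s`. -/
noncomputable def momentMap (s : ℕ) : Polynomial ℝ →ₗ[ℝ] ℝ :=
  Polynomial.lsum fun k => ((k : ℝ) ^ s) • LinearMap.id

theorem momentMap_C_mul_X_pow (s j : ℕ) (c : ℝ) :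
    momentMap s (Polynomial.C c * Polynomial.X ^ j) = c * (j : ℝ) ^ s := by
  rw [momentMap, Polynomial.lsum_apply, Polynomial.C_mul_X_pow_eq_monomial, Polynomial.sum_monomial_index]
  · simp [mul_comm c]
  · simp

theorem momentMap_eq_tsum (s : ℕ) (p : Polynomial ℝ) :
    momentMap s p = ∑' k : ℕ, (k : ℝ) ^ s * p.coeff k := by
  rw [tsum_eq_sum (s := p.support)]
  · simp [momentMap, Polynomial.lsum_apply, Polynomial.sum_def]
  · intro k hk
    rw [Polynomial.notMem_support_iff.1 hk, mul_zero]

theorem momentMap_mul (s : ℕ) (p q : Polynomial ℝ) :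
    momentMap s (p * q) =
      ∑ k ∈ Finset.range (s + 1), (s.choose k : ℝ) * momentMap k p * momentMap (s - k) q := by
  induction p using Polynomial.induction_on' with
  | add p₁ p₂ h₁ h₂ =>
    rw [add_mul, map_add, h₁, h₂, ← Finset.sum_add_distrib]
    exact Finset.sum_congr rfl fun k _ => by rw [map_add]; ring
  | monomial i a =>
    induction q using Polynomial.induction_on' with
    | add q₁ q₂ h₁ h₂ =>
      rw [mul_add, map_add, h₁, h₂, ← Finset.sum_add_distrib]
      exact Finset.sum_congr rfl fun k _ => by rw [map_add]; ring
    | monomial j b =>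
      rw [Polynomial.monomial_mul_monomial]
      simp only [← Polynomial.C_mul_X_pow_eq_monomial, momentMap_C_mul_X_pow]
      rw [Nat.cast_add, add_pow, Finset.mul_sum]
      exact Finset.sum_congr rfl fun k _ => by ring

/-- The mean of a polynomial against the weights `returnWeight m j / 2^m`. -/
noncomputable def returnMean (m : ℕ) : Polynomial ℝ →ₗ[ℝ] ℝ :=
  ∑ j ∈ Finset.range (m + 1), (returnWeight m j / 2 ^ m) • Polynomial.leval (j : ℝ)

theorem returnMean_apply (m : ℕ) (p : Polynomial ℝ) :
    returnMean m p = (∑ j ∈ Finset.range (m + 1), returnWeight m j * p.eval (j : ℝ)) / 2 ^ m := by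
  simp [returnMean, LinearMap.sum_apply, Polynomial.leval_apply, Finset.sum_div, div_mul_eq_mul_div]

theorem momentMap_returnPoly (s m : ℕ) :
    momentMap s (returnPoly m) = 2 ^ m * returnMean m (Polynomial.X ^ s) := by
  rw [returnMean_apply, mul_div_cancel₀ _ (by positivity), returnPoly, map_sum]
  simp [momentMap_C_mul_X_pow]

theorem momentMap_X_mul_returnPoly (s m : ℕ) :
    momentMap s (Polynomial.X * returnPoly m) = 2 ^ m * returnMean m ((Polynomial.X + 1) ^ s) := by
  rw [returnMean_apply, mul_div_cancel₀ _ (by positivity), returnPoly, Finset.mul_sum, map_sum]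
  refine Finset.sum_congr rfl fun j _ => ?_
  rw [mul_left_comm, ← pow_succ', momentMap_C_mul_X_pow]
  simp

/-- The value `C(m, ⌈m/2⌉) / 2^m` of the normalized weight at `0`. -/
noncomputable def returnProb (m : ℕ) : ℝ := returnWeight m 0 / 2 ^ m

theorem momentMap_guessPoly (s m : ℕ) :
    momentMap s (guessPoly m) / 2 ^ m =
      returnMean m (Polynomial.C (1 / 2) * (Polynomial.X ^ s + (Polynomial.X + 1) ^ s))
      + returnProb m * ((0 ^ s - 1) / 2)
      + ((m % 2 : ℕ) : ℝ) * (returnMean m ((Polynomial.X + 1) ^ s - Polynomial.X ^ s)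
        + returnProb m * 0 ^ s) := by
  have hC : ∀ c : ℝ, momentMap s (Polynomial.C c) = c * 0 ^ s := fun c => by
    simpa using momentMap_C_mul_X_pow s 0 c
  have hX : ∀ c : ℝ, momentMap s (Polynomial.X * Polynomial.C c) = c := fun c => by
    rw [mul_comm]; simpa using momentMap_C_mul_X_pow s 1 c
  have h := congrArg (momentMap s) (two_mul_guessPoly m)
  have hmul : ∀ (c : ℝ) (p : Polynomial ℝ), momentMap s (Polynomial.C c * p) = c * momentMap s p :=
    fun c p => by rw [← Polynomial.smul_eq_C_mul, map_smul, smul_eq_mul]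
  have hmul' : ∀ (c : ℝ) (p : Polynomial ℝ), returnMean m (Polynomial.C c * p) = c * returnMean m p :=
    fun c p => by rw [← Polynomial.smul_eq_C_mul, map_smul, smul_eq_mul]
  rw [show (2 : Polynomial ℝ) = Polynomial.C 2 from rfl, mul_assoc] at h
  simp only [map_add, mul_sub, sub_mul, one_mul, map_sub, hmul, hC, hX, momentMap_returnPoly,
    momentMap_X_mul_returnPoly] at h
  rw [hmul', map_add, map_sub]
  have h2 : (2 : ℝ) ^ m ≠ 0 := by positivity
  rw [div_eq_iff h2]
  have h3 : returnWeight m 0 = returnProb m * 2 ^ m := by rw [returnProb, div_mul_cancel₀ _ h2]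
  rw [h3] at h
  linear_combination h / 2

theorem returnMean_one (m : ℕ) :
    returnMean m 1 = 1 - ((m % 2 : ℕ) : ℝ) * returnProb m := by
  have h := congrArg (Polynomial.eval 1) (two_mul_guessPoly m)
  have h1 : (returnPoly m).eval 1 = 2 ^ m * returnMean m 1 := by
    rw [returnMean_apply, mul_div_cancel₀ _ (by positivity), returnPoly, Polynomial.eval_finsetSum]
    simp
  simp only [Polynomial.eval_add, Polynomial.eval_mul, Polynomial.eval_sub, Polynomial.eval_X,
    Polynomial.eval_C, Polynomial.eval_one, Polynomial.eval_ofNat, guessPoly_eval_one, h1] at h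
  have h2 : (2 : ℝ) ^ m ≠ 0 := by positivity
  rw [returnProb, eq_sub_iff_add_eq, ← mul_right_inj' h2]
  field_simp
  linear_combination -h / 2

theorem sub_mul_returnWeight_sub_succ {m j : ℕ} (hj : j ≤ m) :
    ((m : ℝ) - j) * (returnWeight m j - returnWeight m (j + 1)) =
      (j + ((m % 2 : ℕ) : ℝ)) * returnWeight m j := by
  have hh : ((m % 2 : ℕ) : ℝ) = 2 * (((m + 1) / 2 : ℕ) : ℝ) - m := by
    rw [eq_sub_iff_add_eq]
    exact_mod_cast (by omega : m % 2 + m = 2 * ((m + 1) / 2))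
  rcases hj.eq_or_lt with rfl | hj
  · rcases j with _ | j
    · simp
    · simp [returnWeight, Nat.choose_eq_zero_of_lt (show 0 < (j + 1 + 1) / 2 by omega)]
  · obtain ⟨N, rfl⟩ : ∃ N, m = j + N + 1 := ⟨m - j - 1, by omega⟩
    rw [hh]
    simp only [returnWeight]
    rw [show j + N + 1 - (j + 1) = N by omega, show j + N + 1 - j = N + 1 by omega]
    generalize (j + N + 1 + 1) / 2 = h
    have key : (N.choose h : ℝ) * (N + 1) = ((N + 1).choose h : ℝ) * (N + 1 - h) := by
      rcases le_or_gt h (N + 1) with hN | hN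
      · have := Nat.choose_mul_succ_eq N h
        have h2 : ((N + 1 - h : ℕ) : ℝ) = N + 1 - h := by push_cast [Nat.cast_sub hN]; ring
        rw [← h2]
        exact_mod_cast this
      · rw [Nat.choose_eq_zero_of_lt (by omega), Nat.choose_eq_zero_of_lt hN]
        simp
    push_cast
    rw [pow_succ]
    linear_combination (-(2 : ℝ) * 2 ^ j) * key

theorem returnMean_X_pow_succ (m k : ℕ) :
    returnMean m (Polynomial.X ^ (k + 1)) =
      (m + 1) * (-1) ^ k * returnProb m
      + (m + 1) * returnMean m (Polynomial.X ^ k - (Polynomial.X - 1) ^ k)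
      - returnMean m (Polynomial.X * (Polynomial.X ^ k - (Polynomial.X - 1) ^ k))
      - (1 + ((m % 2 : ℕ) : ℝ)) * returnMean m (Polynomial.X ^ k) := by
  have h2 : (2 : ℝ) ^ m ≠ 0 := by positivity
  have h1 : ∑ j ∈ Finset.range (m + 1), ((m : ℝ) - j) * returnWeight m j * (j : ℝ) ^ k
      - ∑ j ∈ Finset.range (m + 1), ((m : ℝ) - j) * returnWeight m (j + 1) * (j : ℝ) ^ k
      = ∑ j ∈ Finset.range (m + 1), (j + ((m % 2 : ℕ) : ℝ)) * returnWeight m j * (j : ℝ) ^ k := by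
    rw [← Finset.sum_sub_distrib]
    refine Finset.sum_congr rfl fun j hj => ?_
    rw [← sub_mul_returnWeight_sub_succ (by have := Finset.mem_range.1 hj; omega)]
    ring
  have h3 : ∑ j ∈ Finset.range (m + 1), ((m : ℝ) - j) * returnWeight m (j + 1) * (j : ℝ) ^ k
      = ∑ j ∈ Finset.range (m + 1), ((m : ℝ) + 1 - j) * returnWeight m j * ((j : ℝ) - 1) ^ k
        - (m + 1) * (-1) ^ k * returnWeight m 0 := by
    rw [Finset.sum_range_succ, Finset.sum_range_succ' _ m]
    push_cast
    simp only [add_sub_cancel_right, sub_self, zero_mul, zero_sub, sub_zero, add_sub_add_right_eq_sub]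
    ring
  have h4 : ∑ j ∈ Finset.range (m + 1), returnWeight m j * (j : ℝ) ^ (k + 1)
      = (m + 1) * ∑ j ∈ Finset.range (m + 1), returnWeight m j * ((j : ℝ) ^ k - ((j : ℝ) - 1) ^ k)
        - ∑ j ∈ Finset.range (m + 1), returnWeight m j * (j * ((j : ℝ) ^ k - ((j : ℝ) - 1) ^ k))
        - (1 + ((m % 2 : ℕ) : ℝ)) * ∑ j ∈ Finset.range (m + 1), returnWeight m j * (j : ℝ) ^ k
        + ∑ j ∈ Finset.range (m + 1), (j + ((m % 2 : ℕ) : ℝ)) * returnWeight m j * (j : ℝ) ^ k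
        - ∑ j ∈ Finset.range (m + 1), ((m : ℝ) - j) * returnWeight m j * (j : ℝ) ^ k
        + ∑ j ∈ Finset.range (m + 1), ((m : ℝ) + 1 - j) * returnWeight m j * ((j : ℝ) - 1) ^ k := by
    simp only [Finset.mul_sum, ← Finset.sum_sub_distrib, ← Finset.sum_add_distrib]
    exact Finset.sum_congr rfl fun j _ => by ring
  simp only [returnMean_apply, returnProb, Polynomial.eval_mul, Polynomial.eval_sub,
    Polynomial.eval_pow, Polynomial.eval_X, Polynomial.eval_one]
  rw [h4]
  field_simp
  linear_combination -h1 - h3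

theorem returnProb_nonneg (m : ℕ) : 0 ≤ returnProb m := by
  unfold returnProb returnWeight
  positivity

theorem returnProb_eq_centralBinom_div (m : ℕ) :
    returnProb m = (((m + 1) / 2).centralBinom : ℝ) / 4 ^ ((m + 1) / 2) := by
  have h4 : ∀ p : ℕ, (4 : ℝ) ^ p = 2 ^ (2 * p) := fun p => by rw [pow_mul]; norm_num
  rcases Nat.even_or_odd' m with ⟨p, rfl | rfl⟩
  · rw [show (2 * p + 1) / 2 = p by omega, returnProb, returnWeight, h4, Nat.centralBinom,
      show (2 * p + 1) / 2 = p by omega]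
    simp
  · rw [show (2 * p + 1 + 1) / 2 = p + 1 by omega, returnProb, returnWeight, h4, Nat.centralBinom,
      show (2 * p + 1 + 1) / 2 = p + 1 by omega, show 2 * (p + 1) = 2 * p + 1 + 1 by ring,
      Nat.choose_succ_succ (2 * p + 1) p, Nat.sub_zero, Nat.choose_symm_half p, pow_succ _ (2 * p + 1)]
    push_cast
    field_simp
    ring

theorem wallis_mul_centralBinom_sq (h : ℕ) :
    Real.Wallis.W h * ((h.centralBinom : ℝ) / 4 ^ h) ^ 2 * (2 * h + 1) = 1 := by
  induction h with
  | zero => simp [Real.Wallis.W]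
  | succ h ih =>
    have key : ((h + 1 : ℝ)) * ((h + 1).centralBinom : ℝ) = 2 * (2 * h + 1) * h.centralBinom := by
      exact_mod_cast Nat.succ_mul_centralBinom_succ h
    have hc : ((h + 1).centralBinom : ℝ) = 2 * (2 * h + 1) * h.centralBinom / (h + 1) := by
      rw [eq_div_iff (by positivity), mul_comm, key]
    refine Eq.trans ?_ ih
    rw [Real.Wallis.W_succ, hc, pow_succ]
    push_cast
    field_simp
    ring

theorem tendsto_returnProb_mul_sqrt :
    Tendsto (fun m : ℕ => returnProb m * √(m : ℝ)) atTop (nhds (√2 / √Real.pi)) := by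
  have hdiv : Tendsto (fun m : ℕ => (m + 1) / 2) atTop atTop :=
    tendsto_atTop_mono (fun m => by omega : ∀ m : ℕ, m / 2 ≤ (m + 1) / 2)
      (Nat.tendsto_div_const_atTop (by norm_num))
  have hW : Tendsto (fun m : ℕ => Real.Wallis.W ((m + 1) / 2)) atTop (nhds (Real.pi / 2)) :=
    Real.Wallis.tendsto_W_nhds_pi_div_two.comp hdiv
  have hratio : Tendsto (fun m : ℕ => (m : ℝ) / (2 * (((m + 1) / 2 : ℕ) : ℝ) + 1)) atTop (nhds 1) := by
    have h1 : Tendsto (fun m : ℕ => (m : ℝ) / (m + 2)) atTop (nhds 1) :=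
      tendsto_natCast_div_add_atTop (2 : ℝ)
    refine tendsto_of_tendsto_of_tendsto_of_le_of_le h1 tendsto_const_nhds (fun m => ?_) fun m => ?_
    · have : (2 * (((m + 1) / 2 : ℕ) : ℝ) + 1) ≤ m + 2 := by
        exact_mod_cast (by omega : 2 * ((m + 1) / 2) + 1 ≤ m + 2)
      exact div_le_div_of_nonneg_left (by positivity) (by positivity) this
    · have : (m : ℝ) ≤ 2 * (((m + 1) / 2 : ℕ) : ℝ) + 1 := by
        exact_mod_cast (by omega : m ≤ 2 * ((m + 1) / 2) + 1)
      exact div_le_one_of_le₀ this (by positivity)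
  have h := (hratio.div hW (by positivity)).sqrt
  rw [one_div_div, Real.sqrt_div (by norm_num)] at h
  refine h.congr fun m => ?_
  rw [← Real.sqrt_sq (returnProb_nonneg m), ← Real.sqrt_mul (sq_nonneg _)]
  congr 1
  have hw := wallis_mul_centralBinom_sq ((m + 1) / 2)
  rw [← returnProb_eq_centralBinom_div] at hw
  have hp := Real.Wallis.W_pos ((m + 1) / 2)
  simp only [Pi.div_apply]
  rw [div_div, div_eq_iff (by positivity)]
  linear_combination -(m : ℝ) * hw

theorem tendsto_inv_sqrt_natCast : Tendsto (fun m : ℕ => (√(m : ℝ))⁻¹) atTop (nhds 0) :=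
  tendsto_inv_atTop_zero.comp (Real.tendsto_sqrt_atTop.comp tendsto_natCast_atTop_atTop)

theorem eventually_sqrt_natCast_pos : ∀ᶠ m : ℕ in atTop, 0 < √(m : ℝ) := by
  filter_upwards [eventually_gt_atTop 0] with m hm
  positivity

theorem tendsto_returnProb : Tendsto returnProb atTop (nhds 0) := by
  have h := tendsto_returnProb_mul_sqrt.mul tendsto_inv_sqrt_natCast
  rw [mul_zero] at h
  refine h.congr' ?_
  filter_upwards [eventually_sqrt_natCast_pos] with m hm
  field_simp

theorem tendsto_parity_mul {f : ℕ → ℝ} (hf : Tendsto f atTop (nhds 0)) :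
    Tendsto (fun m : ℕ => ((m % 2 : ℕ) : ℝ) * f m) atTop (nhds 0) := by
  refine squeeze_zero_norm (fun m => ?_) (tendsto_norm_zero.comp hf)
  have h : ((m % 2 : ℕ) : ℝ) ≤ 1 := by exact_mod_cast (by omega : m % 2 ≤ 1)
  rw [norm_mul, Real.norm_natCast]
  exact mul_le_of_le_one_left (norm_nonneg _) h

/-- The absolute moments of a standard normal random variable. -/
noncomputable def halfNormalMoment (k : ℕ) : ℝ :=
  √2 ^ k * Real.Gamma (((k : ℝ) + 1) / 2) / √Real.pi

theorem halfNormalMoment_zero : halfNormalMoment 0 = 1 := by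
  have : √Real.pi ≠ 0 := by positivity
  have h := Real.Gamma_one_half_eq
  rw [one_div] at h
  simp [halfNormalMoment, h, this]

theorem halfNormalMoment_one : halfNormalMoment 1 = √2 / √Real.pi := by
  norm_num [halfNormalMoment, Real.Gamma_one]

theorem halfNormalMoment_add_two (k : ℕ) :
    halfNormalMoment (k + 2) = (k + 1) * halfNormalMoment k := by
  have h : (((k + 2 : ℕ) : ℝ) + 1) / 2 = ((k : ℝ) + 1) / 2 + 1 := by push_cast; ring
  rw [halfNormalMoment, halfNormalMoment, h, Real.Gamma_add_one (by positivity), pow_add,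
    Real.sq_sqrt (by norm_num)]
  ring

theorem tendsto_returnMean_div {p : Polynomial ℝ} {e : ℕ} (hp : p.natDegree ≤ e)
    (h : ∀ i ≤ p.natDegree, Tendsto (fun m : ℕ => returnMean m (Polynomial.X ^ i) / √(m : ℝ) ^ i)
      atTop (nhds (halfNormalMoment i))) :
    Tendsto (fun m : ℕ => returnMean m p / √(m : ℝ) ^ e) atTop
      (nhds (p.coeff e * halfNormalMoment e)) := by
  have hterm : ∀ i ∈ Finset.range (p.natDegree + 1), Tendsto (fun m : ℕ =>
      p.coeff i * (returnMean m (Polynomial.X ^ i) / √(m : ℝ) ^ i) * (√(m : ℝ))⁻¹ ^ (e - i)) atTop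
      (nhds (p.coeff i * halfNormalMoment i * 0 ^ (e - i))) := fun i hi =>
    ((h i (by have := Finset.mem_range.1 hi; omega)).const_mul _).mul
      (tendsto_inv_sqrt_natCast.pow _)
  have hsum := tendsto_finsetSum _ hterm
  have hlim : ∑ i ∈ Finset.range (p.natDegree + 1), p.coeff i * halfNormalMoment i * 0 ^ (e - i)
      = p.coeff e * halfNormalMoment e := by
    rcases hp.eq_or_lt with he | he
    · rw [Finset.sum_eq_single e]
      · simp
      · intro i hi hie
        have := Finset.mem_range.1 hi
        rw [zero_pow (by omega), mul_zero]
      · intro hne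
        exact absurd (Finset.mem_range.2 (by omega)) hne
    · rw [Polynomial.coeff_eq_zero_of_natDegree_lt he, zero_mul]
      refine Finset.sum_eq_zero fun i hi => ?_
      have := Finset.mem_range.1 hi
      rw [zero_pow (by omega), mul_zero]
  rw [hlim] at hsum
  refine hsum.congr' ?_
  filter_upwards [eventually_sqrt_natCast_pos] with m hm
  conv_rhs => rw [p.as_sum_range_C_mul_X_pow, map_sum, Finset.sum_div]
  refine Finset.sum_congr rfl fun i hi => ?_
  have : e = i + (e - i) := by have := Finset.mem_range.1 hi; omega
  rw [← Polynomial.smul_eq_C_mul, map_smul, smul_eq_mul, inv_pow]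
  conv_rhs => rw [this, pow_add]
  field_simp

theorem coeff_X_pow_sub_X_sub_one_pow (k i : ℕ) :
    (Polynomial.X ^ k - (Polynomial.X - 1) ^ k : Polynomial ℝ).coeff i =
      (if i = k then 1 else 0) - (-1) ^ (k - i) * (k.choose i : ℝ) := by
  have : (Polynomial.X - 1 : Polynomial ℝ) = Polynomial.X + Polynomial.C (-1) := by
    simp [sub_eq_add_neg]
  rw [Polynomial.coeff_sub, Polynomial.coeff_X_pow, this, Polynomial.coeff_X_add_C_pow]

theorem natDegree_X_pow_succ_sub_le (k : ℕ) :
    (Polynomial.X ^ (k + 1) - (Polynomial.X - 1) ^ (k + 1) : Polynomial ℝ).natDegree ≤ k := by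
  rw [Polynomial.natDegree_le_iff_coeff_eq_zero]
  intro i hi
  rw [coeff_X_pow_sub_X_sub_one_pow]
  rcases eq_or_ne i (k + 1) with rfl | hne
  · simp
  · rw [if_neg hne, Nat.choose_eq_zero_of_lt (by omega)]
    simp

theorem tendsto_returnMean_X_pow (k : ℕ) :
    Tendsto (fun m : ℕ => returnMean m (Polynomial.X ^ k) / √(m : ℝ) ^ k)
      atTop (nhds (halfNormalMoment k)) := by
  have hone : Tendsto (fun m : ℕ => returnMean m 1) atTop (nhds 1) := by
    simpa [returnMean_one] using (tendsto_parity_mul tendsto_returnProb).const_sub 1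
  have hsq : ∀ m : ℕ, √(m : ℝ) ^ 2 = m := fun m => Real.sq_sqrt m.cast_nonneg
  have hshift : Tendsto (fun m : ℕ => ((m : ℝ) + 1) / √(m : ℝ) ^ 2) atTop (nhds 1) := by
    have h := (tendsto_inv_sqrt_natCast.pow 2).const_add 1
    rw [zero_pow (by norm_num), add_zero] at h
    refine h.congr' ?_
    filter_upwards [eventually_sqrt_natCast_pos] with m hm
    rw [hsq, inv_pow, hsq]
    have : (m : ℝ) ≠ 0 := by rw [← hsq]; positivity
    field_simp
  induction k using Nat.strong_induction_on with
  | _ k ih =>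
  rcases k with _ | _ | k
  · simpa [halfNormalMoment_zero] using hone
  · have h1 := (hone.mul tendsto_inv_sqrt_natCast)
    rw [mul_zero] at h1
    have h := ((hshift.mul tendsto_returnProb_mul_sqrt).sub h1).sub (tendsto_parity_mul h1)
    rw [one_mul, sub_zero, sub_zero] at h
    rw [halfNormalMoment_one]
    refine h.congr' ?_
    filter_upwards [eventually_sqrt_natCast_pos] with m hm
    rw [returnMean_X_pow_succ]
    simp only [pow_zero, sub_self, mul_zero, map_zero, mul_one]
    field_simp
    ring
  · set D : Polynomial ℝ := Polynomial.X ^ (k + 1) - (Polynomial.X - 1) ^ (k + 1) with hD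
    have hdeg : D.natDegree ≤ k := natDegree_X_pow_succ_sub_le k
    have hcoeff : D.coeff k = k + 1 := by
      rw [hD, coeff_X_pow_sub_X_sub_one_pow]
      simp
    have hXdeg : (Polynomial.X * D).natDegree ≤ k + 1 :=
      (Polynomial.natDegree_mul_le).trans (by rw [Polynomial.natDegree_X]; omega)
    have hlead := tendsto_returnMean_div hdeg fun i hi => ih i (by omega)
    have hX := tendsto_returnMean_div (e := k + 2) (by omega : (Polynomial.X * D).natDegree ≤ k + 2)
      fun i hi => ih i (by omega)
    have hlow := (ih (k + 1) (by omega)).mul tendsto_inv_sqrt_natCast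
    rw [Polynomial.coeff_eq_zero_of_natDegree_lt (by omega), zero_mul] at hX
    rw [mul_zero] at hlow
    have hprob := ((hshift.mul tendsto_returnProb_mul_sqrt).mul
      (tendsto_inv_sqrt_natCast.pow (k + 1))).const_mul ((-1 : ℝ) ^ (k + 1))
    rw [zero_pow (by omega), mul_zero, mul_zero] at hprob
    have h := (((hprob.add (hshift.mul hlead)).sub hX).sub hlow).sub (tendsto_parity_mul hlow)
    rw [zero_add, one_mul, sub_zero, sub_zero, sub_zero, hcoeff, ← halfNormalMoment_add_two] at h
    refine h.congr' ?_
    filter_upwards [eventually_sqrt_natCast_pos] with m hm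
    rw [returnMean_X_pow_succ m (k + 1), ← hD]
    generalize returnMean m D = d₁
    generalize returnMean m (Polynomial.X * D) = d₂
    generalize returnMean m (Polynomial.X ^ (k + 1)) = d₃
    rw [inv_pow]
    field_simp
    ring

theorem tendsto_momentMap_guessPoly (s : ℕ) :
    Tendsto (fun m : ℕ => momentMap s (guessPoly m) / 2 ^ m / √(m : ℝ) ^ s)
      atTop (nhds (halfNormalMoment s)) := by
  have hcomp : ((Polynomial.X + 1) ^ s : Polynomial ℝ) = (Polynomial.X + Polynomial.C 1) ^ s := by
    simp
  have hdeg : ((Polynomial.X + 1) ^ s : Polynomial ℝ).natDegree ≤ s := by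
    rw [hcomp, Polynomial.natDegree_pow_X_add_C]
  have hcoeff : ((Polynomial.X + 1) ^ s : Polynomial ℝ).coeff s = 1 := by
    rw [hcomp, Polynomial.coeff_X_add_C_pow]
    simp
  have hXdeg : (Polynomial.X ^ s : Polynomial ℝ).natDegree ≤ s := (Polynomial.natDegree_X_pow s).le
  have h1 := tendsto_returnMean_div (e := s)
    (p := Polynomial.C (1 / 2) * (Polynomial.X ^ s + (Polynomial.X + 1) ^ s))
    ((Polynomial.natDegree_C_mul_le _ _).trans (Polynomial.natDegree_add_le_of_degree_le hXdeg hdeg))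
    fun i _ => tendsto_returnMean_X_pow i
  have h2 := tendsto_returnMean_div (e := s)
    (p := (Polynomial.X + 1) ^ s - Polynomial.X ^ s)
    ((Polynomial.natDegree_sub_le _ _).trans (max_le hdeg hXdeg))
    fun i _ => tendsto_returnMean_X_pow i
  rw [Polynomial.coeff_C_mul, Polynomial.coeff_add, hcoeff, Polynomial.coeff_X_pow_self] at h1
  rw [Polynomial.coeff_sub, hcoeff, Polynomial.coeff_X_pow_self, sub_self, zero_mul] at h2
  have h3 := tendsto_returnProb.mul (tendsto_inv_sqrt_natCast.pow s)
  rw [zero_mul] at h3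
  have h4 := (h3.mul_const (0 ^ s))
  rw [zero_mul] at h4
  have h24 := h2.add h4
  rw [add_zero] at h24
  have h := (h1.add (h3.mul_const ((0 ^ s - 1) / 2))).add (tendsto_parity_mul h24)
  rw [show (1 / 2 : ℝ) * (1 + 1) * halfNormalMoment s + 0 * ((0 ^ s - 1) / 2) + 0
    = halfNormalMoment s by ring] at h
  refine h.congr fun m => ?_
  rw [momentMap_guessPoly, inv_pow]
  ring

theorem fP_eq_guessPoly_mul (n : ℕ) :
    fP n = 4 * Polynomial.X ^ 4 - 2 * (Polynomial.X ^ 2 + Polynomial.X ^ 3)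
      + guessPoly ((n + 1) / 2) * guessPoly (n - (n + 1) / 2) := by
  rw [fP, guessPoly, guessPoly, Finset.sum_mul_sum]

theorem sum_choose_mul_halfNormalMoment (s : ℕ) :
    ∑ k ∈ Finset.range (s + 1), (s.choose k : ℝ) * (halfNormalMoment k * (√2)⁻¹ ^ k)
      * (halfNormalMoment (s - k) * (√2)⁻¹ ^ (s - k)) = mutilde s := by
  rw [mutilde]
  refine Finset.sum_congr rfl fun k hk => ?_
  have hk' : k ≤ s := by have := Finset.mem_range.1 hk; omega
  have h2 : √2 ≠ 0 := by positivity
  have hpi : √Real.pi * √Real.pi = Real.pi := Real.mul_self_sqrt Real.pi_pos.le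
  rw [halfNormalMoment, halfNormalMoment, inv_pow, inv_pow, Nat.cast_sub hk']
  conv_rhs => rw [← hpi]
  field_simp

theorem tendsto_sqrt_natCast_div {f : ℕ → ℕ} (hf : ∀ n, 2 * f n ≤ n + 1) (hf' : ∀ n, n ≤ 2 * f n + 1) :
    Tendsto (fun n => √(f n : ℝ) / √(n : ℝ)) atTop (nhds (√2)⁻¹) := by
  have h : Tendsto (fun n : ℕ => (f n : ℝ) / n) atTop (nhds 2⁻¹) := by
    have h0 : Tendsto (fun n : ℕ => (n : ℝ)⁻¹) atTop (nhds 0) := tendsto_inv_atTop_nhds_zero_nat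
    have hl : Tendsto (fun n : ℕ => (2 : ℝ)⁻¹ - 2⁻¹ * (n : ℝ)⁻¹) atTop (nhds 2⁻¹) := by
      simpa using (h0.const_mul (2 : ℝ)⁻¹).const_sub (2 : ℝ)⁻¹
    have hu : Tendsto (fun n : ℕ => (2 : ℝ)⁻¹ + 2⁻¹ * (n : ℝ)⁻¹) atTop (nhds 2⁻¹) := by
      simpa using (h0.const_mul (2 : ℝ)⁻¹).const_add (2 : ℝ)⁻¹
    refine tendsto_of_tendsto_of_tendsto_of_le_of_le' hl hu ?_ ?_
    · filter_upwards [eventually_gt_atTop 0] with n hn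
      have h1 : (n : ℝ) ≤ 2 * f n + 1 := by exact_mod_cast hf' n
      have h2 : (0 : ℝ) < n := by exact_mod_cast hn
      rw [le_div_iff₀ h2]
      field_simp
      linarith
    · filter_upwards [eventually_gt_atTop 0] with n hn
      have h1 : (2 : ℝ) * f n ≤ n + 1 := by exact_mod_cast hf n
      have h2 : (0 : ℝ) < n := by exact_mod_cast hn
      rw [div_le_iff₀ h2]
      field_simp
      linarith
  rw [← Real.sqrt_inv]
  exact h.sqrt.congr fun n => Real.sqrt_div (Nat.cast_nonneg _) _

theorem tendsto_atTop_of_le_two_mul_add_one {f : ℕ → ℕ} (hf : ∀ n, n ≤ 2 * f n + 1) :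
    Tendsto f atTop atTop :=
  tendsto_atTop_mono (fun n => by have := hf n; omega : ∀ n : ℕ, n / 2 ≤ f n)
    (Nat.tendsto_div_const_atTop (by norm_num))

theorem tendsto_momentMap_guessPoly_comp {f : ℕ → ℕ} (hf : ∀ n, 2 * f n ≤ n + 1)
    (hf' : ∀ n, n ≤ 2 * f n + 1) (k : ℕ) :
    Tendsto (fun n : ℕ => momentMap k (guessPoly (f n)) / 2 ^ f n / √(n : ℝ) ^ k) atTop
      (nhds (halfNormalMoment k * (√2)⁻¹ ^ k)) := by
  have hatTop := tendsto_atTop_of_le_two_mul_add_one hf'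
  refine (((tendsto_momentMap_guessPoly k).comp hatTop).mul
    ((tendsto_sqrt_natCast_div hf hf').pow k)).congr' ?_
  filter_upwards [hatTop.eventually eventually_sqrt_natCast_pos] with n hn
  simp only [Function.comp_apply, div_pow]
  field_simp

theorem stmt8 (s : ℕ) (hs : 1 ≤ s) :
    Tendsto (fun n : ℕ =>
        (1 / (2 ^ n * (n : ℝ) ^ ((s : ℝ) / 2))) * ∑' k : ℕ, (k : ℝ) ^ s * (fP n).coeff k)
      atTop (nhds (mutilde s)) := by
  have h2 : ∀ c : ℝ, Tendsto (fun n : ℕ => c / 2 ^ n / √(n : ℝ) ^ s) atTop (nhds 0) := fun c => by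
    have h := ((tendsto_pow_atTop_nhds_zero_of_lt_one (r := (2 : ℝ)⁻¹) (by norm_num)
      (by norm_num)).const_mul c).mul (tendsto_inv_sqrt_natCast.pow s)
    rw [mul_zero, zero_mul] at h
    refine h.congr fun n => ?_
    rw [inv_pow, inv_pow]
    ring
  have hmain : ∀ k ∈ Finset.range (s + 1), Tendsto (fun n : ℕ => (s.choose k : ℝ)
      * (momentMap k (guessPoly ((n + 1) / 2)) / 2 ^ ((n + 1) / 2) / √(n : ℝ) ^ k)
      * (momentMap (s - k) (guessPoly (n - (n + 1) / 2)) / 2 ^ (n - (n + 1) / 2)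
        / √(n : ℝ) ^ (s - k))) atTop
      (nhds ((s.choose k : ℝ) * (halfNormalMoment k * (√2)⁻¹ ^ k)
        * (halfNormalMoment (s - k) * (√2)⁻¹ ^ (s - k)))) := fun k _ =>
    ((tendsto_momentMap_guessPoly_comp (fun n => by omega) (fun n => by omega) k).const_mul _).mul
      (tendsto_momentMap_guessPoly_comp (f := fun n => n - (n + 1) / 2)
        (fun n => by omega) (fun n => by omega) (s - k))
  have h := (h2 (momentMap s (4 * Polynomial.X ^ 4
    - 2 * (Polynomial.X ^ 2 + Polynomial.X ^ 3)))).add (tendsto_finsetSum _ hmain)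
  rw [zero_add, sum_choose_mul_halfNormalMoment] at h
  refine h.congr fun n => ?_
  rw [← momentMap_eq_tsum, fP_eq_guessPoly_mul, map_add, momentMap_mul, mul_add (1 / _), Finset.mul_sum,
    show (n : ℝ) ^ ((s : ℝ) / 2) = √(n : ℝ) ^ s by
      rw [Real.sqrt_eq_rpow, ← Real.rpow_mul_natCast n.cast_nonneg]; congr 1; ring]
  congr 1
  · ring
  · refine Finset.sum_congr rfl fun k hk => ?_
    have hk' : s = k + (s - k) := by have := Finset.mem_range.1 hk; omega
    have hn : (2 : ℝ) ^ n = 2 ^ ((n + 1) / 2) * 2 ^ (n - (n + 1) / 2) := by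
      rw [← pow_add]; congr 1; omega
    have hs' : √(n : ℝ) ^ s = √(n : ℝ) ^ k * √(n : ℝ) ^ (s - k) := by rw [← pow_add, ← hk']
    rw [hn, hs']
    ring
end

section
/- For every real x ≥ 0, P(X_n ≤ x·√n) = (1/2^n)·Σ_{0 ≤ k ≤ x·√n} [q^k] f_n(q) converges, as n → ∞, to ∫_0^x 4·φ(t)·(2·Φ(t) − 1) dt, where φ(t) = e^{−t²/2}/√(2π) and Φ(t) = ∫_{−∞}^t φ(u) du are the density and cumulative distribution function of the standard normal distribution. In other words, X_n/√n converges in distribution to the sum of two independent half-normal random variables, whose law has density f(x) = 4·φ(x)·(2·Φ(x) − 1) on [0,∞). -/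
/-- The standard normal density `φ`. -/
noncomputable def stdphi (t : ℝ) : ℝ := Real.exp (-t ^ 2 / 2) / Real.sqrt (2 * Real.pi)

/-- The standard normal cumulative distribution function `Φ`. -/
noncomputable def stdPhi (t : ℝ) : ℝ := ∫ u in Set.Iic t, stdphi u

open Filter

/-- The sum of the coefficients of `p` of degree at least `k`. -/
noncomputable def coeffTail (p : Polynomial ℝ) (k : ℕ) : ℝ :=
  p.eval 1 - ∑ j ∈ Finset.range k, p.coeff j

lemma coeffTail_zero (p : Polynomial ℝ) : coeffTail p 0 = p.eval 1 := by
  simp [coeffTail]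

lemma coeffTail_add (p r : Polynomial ℝ) (k : ℕ) :
    coeffTail (p + r) k = coeffTail p k + coeffTail r k := by
  simp only [coeffTail, Polynomial.eval_add, Polynomial.coeff_add, Finset.sum_add_distrib]
  ring

lemma coeffTail_X_mul (p : Polynomial ℝ) (k : ℕ) :
    coeffTail (Polynomial.X * p) (k + 1) = coeffTail p k := by
  simp [coeffTail, Finset.sum_range_succ', Polynomial.coeff_X_mul]

lemma coeffTail_one (k : ℕ) : coeffTail 1 (k + 1) = 0 := by
  simp [coeffTail, Polynomial.coeff_one]

lemma eval_one_gP (a b : ℕ) : (gP a b).eval 1 = (a + b).choose a := by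
  fun_induction gP a b with
  | case1 => simp
  | case2 b ih => simpa using ih
  | case3 a ih =>
    simpa only [Polynomial.eval_mul, Polynomial.eval_pow, Polynomial.eval_X, one_pow, one_mul,
      add_zero, Nat.choose_self] using ih
  | case4 a b ih1 ih2 =>
    rw [show a + 1 + (b + 1) = (a + (b + 1)) + 1 by ring, Nat.choose_succ_succ]
    simp only [Polynomial.eval_add, Polynomial.eval_mul, Polynomial.eval_pow, Polynomial.eval_X,
      one_pow, one_mul, ih1, ih2, Nat.cast_add]
    congr 3
    ring

lemma gP_coeff_nonneg (a b k : ℕ) : 0 ≤ (gP a b).coeff k := by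
  have key (p : Polynomial ℝ) (hp : ∀ k, 0 ≤ p.coeff k) (e k : ℕ) :
      0 ≤ (Polynomial.X ^ e * p).coeff k := by
    rw [Polynomial.coeff_X_pow_mul']
    split_ifs
    exacts [hp _, le_rfl]
  fun_induction gP a b generalizing k with
  | case1 => rw [Polynomial.coeff_one]; split_ifs <;> norm_num
  | case2 b ih => exact ih k
  | case3 a ih => exact key _ ih _ k
  | case4 a b ih1 ih2 =>
    rw [Polynomial.coeff_add]
    exact add_nonneg (key _ ih1 _ k) (ih2 k)

/-- Pascal's rule with a truncated subtraction in the upper index. -/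
lemma choose_sub_succ (N k j : ℕ) (h : 0 < j ∨ k ≤ N) :
    (N + 1 - k).choose (j + 1) = (N - k).choose j + (N - k).choose (j + 1) := by
  rcases le_or_gt k N with hk | hk
  · rw [Nat.succ_sub hk, Nat.choose_succ_succ]
  · obtain ⟨i, rfl⟩ : ∃ i, j = i + 1 := ⟨j - 1, by omega⟩
    rw [show N + 1 - k = 0 by omega, show N - k = 0 by omega]
    simp

lemma coeffTail_gP_zero_left (b k : ℕ) : coeffTail (gP 0 b) (k + 1) = 0 := by
  induction b with
  | zero => rw [gP]; exact coeffTail_one k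
  | succ b ih => rw [gP]; exact ih

lemma coeffTail_gP (a b : ℕ) :
    (∀ k, a ≤ b + 1 →
      coeffTail (gP a b) (k + 1) = 2 ^ k * ((a + b - k).choose (b + 1) : ℝ)) ∧
    (b + 2 ≤ a → coeffTail (gP a b) 1 = ((a + b).choose a : ℝ)) ∧
    (∀ k, b + 2 ≤ a →
      coeffTail (gP a b) (k + 2) = 2 ^ k * ((a + b - k).choose a : ℝ)) := by
  fun_induction gP a b with
  | case1 =>
    refine ⟨fun k _ => ?_, fun h => by omega, fun k h => by omega⟩
    simp [coeffTail_one]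
  | case2 b ih =>
    refine ⟨fun k _ => ?_, fun h => by omega, fun k h => by omega⟩
    rw [coeffTail_gP_zero_left, Nat.choose_eq_zero_of_lt (by omega)]
    simp
  | case3 a ih =>
    obtain ⟨ih1, ih2, ih3⟩ := ih
    rcases Nat.lt_or_ge a 2 with ha | ha
    · rw [if_pos (by omega), pow_one]
      refine ⟨fun k h => ?_, fun h => ?_, fun k h => ?_⟩
      · obtain rfl : a = 0 := by omega
        rw [coeffTail_X_mul]
        cases k with
        | zero => simp [coeffTail_zero, eval_one_gP]
        | succ k => simp [coeffTail_gP_zero_left]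
      · rw [coeffTail_X_mul, coeffTail_zero, eval_one_gP]
        simp
      · obtain rfl : a = 1 := by omega
        rw [coeffTail_X_mul, ih1 k (by omega), choose_sub_succ 1 k 1 (by omega),
          Nat.choose_eq_zero_of_lt (show 1 - k < 1 + 1 by omega)]
        simp
    · rw [if_neg (by omega), pow_zero, one_mul]
      refine ⟨fun k h => by omega, fun h => ?_, fun k h => ?_⟩
      · simpa using ih2 (by omega)
      · rw [ih3 k (by omega), add_zero, add_zero, choose_sub_succ a k a (by omega),
          Nat.choose_eq_zero_of_lt (show a - k < a + 1 by omega), add_zero]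
  | case4 a b ih1 ih2 =>
    obtain ⟨A1, B1, C1⟩ := ih1
    obtain ⟨A2, B2, C2⟩ := ih2
    have e1 : a + (b + 1) = a + b + 1 := by ring
    have e2 : a + 1 + b = a + b + 1 := by ring
    have e3 : a + 1 + (b + 1) = (a + b + 1) + 1 := by ring
    rw [e1] at A1 B1 C1
    rw [e2] at A2 B2 C2
    rw [e3]
    simp only [coeffTail_add, Nat.succ_eq_add_one]
    rcases Nat.lt_or_ge b a with hab | hab
    · rcases Nat.lt_or_ge (b + 2) a with h3 | h3
      · rw [if_neg (by omega), pow_zero, one_mul]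
        refine ⟨fun k h => by omega, fun h => ?_, fun k h => ?_⟩
        · rw [B1 (by omega), B2 (by omega), Nat.choose_succ_succ' (a + b + 1) a]
          push_cast
          ring
        · rw [C1 k (by omega), C2 k (by omega), choose_sub_succ (a + b + 1) k a (by omega)]
          push_cast
          ring
      · rw [if_pos (by omega), pow_one]
        simp only [coeffTail_X_mul]
        refine ⟨fun k h => ?_, fun h => ?_, fun k h => ?_⟩
        · obtain rfl : a = b + 1 := by omega
          cases k with
          | zero =>
            rw [coeffTail_zero, eval_one_gP, zero_add, B2 (by omega)]
            have := Nat.choose_succ_succ (b + 1 + b + 1) (b + 1)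
            simp only [Nat.sub_zero, pow_zero, one_mul]
            rw [this, e1]
            push_cast
            ring
          | succ k =>
            rw [A1 k (by omega), C2 k (by omega), Nat.add_sub_add_right]
            ring
        · obtain rfl : a = b + 2 := by omega
          rw [coeffTail_zero, eval_one_gP, B2 (by omega), Nat.choose_succ_succ' (b + 2 + b + 1) (b + 2), e1]
          push_cast
          ring
        · obtain rfl : a = b + 2 := by omega
          rw [A1 k (by omega), C2 k (by omega), choose_sub_succ (b + 2 + b + 1) k (b + 2) (by omega)]
          push_cast
          ring
    · rw [if_neg (by omega), pow_zero, one_mul]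
      refine ⟨fun k h => ?_, fun h => by omega, fun k h => by omega⟩
      rw [A1 k (by omega), A2 k (by omega), choose_sub_succ (a + b + 1) k (b + 1) (by omega)]
      push_cast
      ring

open MeasureTheory ProbabilityTheory Topology

/-- The mass of `{c, c + 1, …}` under the symmetric binomial distribution with `m` trials. -/
noncomputable def binomialTail (m c : ℕ) : ℝ :=
  ∑ j ∈ Finset.range (m + 1), if c ≤ j then (m.choose j : ℝ) / 2 ^ m else 0

lemma binomialTail_eq_of_le {m M : ℕ} (h : m ≤ M) (c : ℕ) :
    binomialTail m c =
      ∑ j ∈ Finset.range (M + 1), if c ≤ j then (m.choose j : ℝ) / 2 ^ m else 0 := by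
  refine Finset.sum_subset (Finset.range_subset_range.2 (by omega)) fun j _ hj => ?_
  rw [Nat.choose_eq_zero_of_lt (by simpa using hj)]
  simp

/-- The generating polynomial of one of the two packets. -/
noncomputable def packetPoly (N : ℕ) : Polynomial ℝ :=
  ∑ a ∈ Finset.range (N + 1), gP a (N - a)

lemma packetPoly_coeff_nonneg (N k : ℕ) : 0 ≤ (packetPoly N).coeff k := by
  rw [packetPoly, Polynomial.finsetSum_coeff]
  exact Finset.sum_nonneg fun _ _ => gP_coeff_nonneg _ _ _

lemma eval_one_packetPoly (N : ℕ) : (packetPoly N).eval 1 = 2 ^ N := by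
  rw [packetPoly, Polynomial.eval_finsetSum]
  have := Nat.sum_range_choose N
  rw [← Nat.cast_inj (R := ℝ)] at this
  push_cast at this
  rw [← this]
  refine Finset.sum_congr rfl fun a ha => ?_
  rw [eval_one_gP, Nat.add_sub_cancel' (by simpa [Nat.lt_succ_iff] using ha)]

lemma coeffTail_sum {ι : Type*} (s : Finset ι) (p : ι → Polynomial ℝ) (k : ℕ) :
    coeffTail (∑ i ∈ s, p i) k = ∑ i ∈ s, coeffTail (p i) k := by
  classical
  induction s using Finset.induction_on with
  | empty => simp [coeffTail]
  | insert i s hi ih => rw [Finset.sum_insert hi, Finset.sum_insert hi, coeffTail_add, ih]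

lemma coeffTail_packetPoly (N k : ℕ) (hk : k + 1 ≤ N) :
    coeffTail (packetPoly N) (k + 2) / 2 ^ N =
      binomialTail (N - (k + 1)) ((N + 2) / 2) + binomialTail (N - k) ((N + 3) / 2) := by
  have h1 (a : ℕ) (ha : a ∈ Finset.range (N + 1)) : coeffTail (gP a (N - a)) (k + 2) / 2 ^ N =
      (if a ≤ N - a + 1 then
        ((N - (k + 1)).choose (N - a + 1) : ℝ) / 2 ^ (N - (k + 1)) else 0) +
      (if (N + 3) / 2 ≤ a then ((N - k).choose a : ℝ) / 2 ^ (N - k) else 0) := by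
    have haN : a ≤ N := by simpa [Nat.lt_succ_iff] using ha
    have e : a + (N - a) = N := by omega
    obtain ⟨A, -, C⟩ := coeffTail_gP a (N - a)
    have p1 : (2 : ℝ) ^ N = 2 ^ (k + 1) * 2 ^ (N - (k + 1)) := by
      rw [← pow_add, Nat.add_sub_cancel' hk]
    have p2 : (2 : ℝ) ^ N = 2 ^ k * 2 ^ (N - k) := by
      rw [← pow_add, Nat.add_sub_cancel' (by omega)]
    by_cases h : a ≤ N - a + 1
    · rw [if_pos h, if_neg (by omega), A (k + 1) h, e, add_zero, p1,
        mul_div_mul_left _ _ (by positivity)]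
    · rw [if_neg h, if_pos (by omega), C k (by omega), e, zero_add, p2,
        mul_div_mul_left _ _ (by positivity)]
  rw [packetPoly, coeffTail_sum, Finset.sum_div, Finset.sum_congr rfl h1, Finset.sum_add_distrib,
    ← binomialTail_eq_of_le (Nat.sub_le N k)]
  congr 1
  rw [binomialTail_eq_of_le (show N - (k + 1) ≤ N + 1 by omega), Finset.sum_range_succ' _ (N + 1),
    if_neg (by omega), add_zero, ← Finset.sum_range_reflect]
  refine Finset.sum_congr rfl fun a ha => ?_
  have haN : a ≤ N := by simpa [Nat.lt_succ_iff] using ha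
  rw [show N - (N + 1 - 1 - a) = a by omega]
  exact if_congr (by omega) rfl rfl

/-- The measure `∑ i ∈ s, w i • δ_{f i}`. -/
noncomputable def discreteMeasure {ι Ω : Type*} [MeasurableSpace Ω] (s : Finset ι) (w : ι → ℝ)
    (f : ι → Ω) : Measure Ω :=
  ∑ i ∈ s, ENNReal.ofReal (w i) • Measure.dirac (f i)

section discreteMeasure

variable {ι Ω : Type*} [MeasurableSpace Ω] {s : Finset ι} {w : ι → ℝ} {f : ι → Ω}

instance : IsFiniteMeasure (discreteMeasure s w f) := by
  refine ⟨?_⟩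
  simp [discreteMeasure]

open Classical in
lemma discreteMeasure_real (hw : ∀ i ∈ s, 0 ≤ w i) {A : Set Ω} (hA : MeasurableSet A) :
    (discreteMeasure s w f).real A = ∑ i ∈ s, if f i ∈ A then w i else 0 := by
  rw [measureReal_def, discreteMeasure, Measure.finsetSum_apply, ENNReal.toReal_sum
    fun i _ => by simpa using ENNReal.mul_ne_top ENNReal.ofReal_ne_top (measure_ne_top _ _)]
  refine Finset.sum_congr rfl fun i hi => ?_
  by_cases h : f i ∈ A <;> simp [hA, h, hw i hi]

lemma isProbabilityMeasure_discreteMeasure (hw : ∀ i ∈ s, 0 ≤ w i) (h1 : ∑ i ∈ s, w i = 1) :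
    IsProbabilityMeasure (discreteMeasure s w f) := by
  refine ⟨?_⟩
  rw [discreteMeasure, Measure.finsetSum_apply]
  simp [← ENNReal.ofReal_sum_of_nonneg hw, h1]

lemma integral_discreteMeasure [MeasurableSingletonClass Ω] (hw : ∀ i ∈ s, 0 ≤ w i) (g : Ω → ℂ) :
    ∫ x, g x ∂(discreteMeasure s w f) = ∑ i ∈ s, (w i : ℂ) * g (f i) := by
  rw [discreteMeasure, integral_finsetSum_measure]
  · refine Finset.sum_congr rfl fun i hi => ?_
    simp [hw i hi]
  · intro i hi
    exact (integrable_dirac (by simp)).smul_measure (by simp)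

open Classical in
lemma discreteMeasure_prod_real {κ Ω' : Type*} [MeasurableSpace Ω'] {t : Finset κ} {v : κ → ℝ}
    {g : κ → Ω'} (hw : ∀ i ∈ s, 0 ≤ w i) (hv : ∀ j ∈ t, 0 ≤ v j) {A : Set (Ω × Ω')}
    (hA : MeasurableSet A) :
    ((discreteMeasure s w f).prod (discreteMeasure t v g)).real A =
      ∑ i ∈ s, ∑ j ∈ t, if (f i, g j) ∈ A then w i * v j else 0 := by
  rw [measureReal_def, Measure.prod_apply hA, discreteMeasure, lintegral_finsetSum_measure,
    ENNReal.toReal_sum]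
  · refine Finset.sum_congr rfl fun i hi => ?_
    rw [lintegral_smul_measure, lintegral_dirac' _ (measurable_measure_prodMk_left hA),
      smul_eq_mul, ENNReal.toReal_mul, ← measureReal_def,
      discreteMeasure_real hv (measurable_prodMk_left hA), ENNReal.toReal_ofReal (hw i hi),
      Finset.mul_sum]
    refine Finset.sum_congr rfl fun j _ => ?_
    simp
  · intro i hi
    rw [lintegral_smul_measure, lintegral_dirac' _ (measurable_measure_prodMk_left hA)]
    exact ENNReal.mul_ne_top (by simp) (by finiteness)

end discreteMeasure

/-- The law of the normalised symmetric random walk after `m` steps. -/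
noncomputable def walkMeasure (m : ℕ) : Measure ℝ :=
  discreteMeasure (Finset.range (m + 1)) (fun j => (m.choose j : ℝ) / 2 ^ m)
    (fun j => (√m)⁻¹ * (2 * j - m))

instance (m : ℕ) : IsProbabilityMeasure (walkMeasure m) := by
  refine isProbabilityMeasure_discreteMeasure (fun _ _ => by positivity) ?_
  rw [← Finset.sum_div, div_eq_one_iff_eq (by positivity)]
  exact_mod_cast Nat.sum_range_choose m

lemma charFun_walkMeasure (m : ℕ) (t : ℝ) :
    charFun (walkMeasure m) t = Complex.cos ((√m)⁻¹ * t : ℝ) ^ m := by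
  rw [charFun_apply_real, walkMeasure, integral_discreteMeasure (fun _ _ => by positivity),
    Complex.cos, div_pow, add_pow, Finset.sum_div]
  refine Finset.sum_congr rfl fun j hj => ?_
  have hj : j ≤ m := by simpa [Nat.lt_succ_iff] using hj
  rw [← Complex.exp_nat_mul, ← Complex.exp_nat_mul, ← Complex.exp_add]
  push_cast [Nat.cast_sub hj]
  rw [show (t : ℂ) * ((√m : ℂ)⁻¹ * (2 * j - m)) * Complex.I =
    j * ((√m : ℂ)⁻¹ * t * Complex.I) + (m - j) * (-((√m : ℂ)⁻¹ * t) * Complex.I) by ring]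
  ring

/-- `walkMeasure m` as a bundled probability measure. -/
noncomputable def walkLaw (m : ℕ) : ProbabilityMeasure ℝ := ⟨walkMeasure m, inferInstance⟩

/-- The standard normal distribution as a bundled probability measure. -/
noncomputable def stdNormal : ProbabilityMeasure ℝ := ⟨gaussianReal 0 1, inferInstance⟩

/-- The de Moivre–Laplace theorem. -/
lemma tendsto_walkLaw : Tendsto walkLaw atTop (𝓝 stdNormal) := by
  refine ProbabilityMeasure.tendsto_iff_tendsto_charFun.2 fun t => ?_
  change Tendsto (fun m => charFun (walkMeasure m) t) atTop (𝓝 (charFun (gaussianReal 0 1) t))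
  have hc : charFun (walkMeasure 1) = fun t : ℝ => Complex.cos t := by
    ext t
    simp [charFun_walkMeasure]
  have hm (k : ℕ) : ∫ x, x ^ k ∂(walkMeasure 1) = ((-1) ^ k + 1) / 2 := by
    have := integral_discreteMeasure (s := Finset.range 2) (w := fun j => ((1 : ℕ).choose j : ℝ) / 2 ^ 1)
      (f := fun j => (√(1 : ℕ))⁻¹ * (2 * j - (1 : ℕ))) (fun _ _ => by positivity)
      (fun x : ℝ => ((x ^ k : ℝ) : ℂ))
    rw [integral_complex_ofReal] at this
    apply Complex.ofReal_injective
    refine Eq.trans this ?_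
    simp [Finset.sum_range_succ]
    norm_num
    ring
  have h := tendsto_charFun_inv_sqrt_mul_pow (P := walkMeasure 1) (X := id) aemeasurable_id
    (by simpa using hm 1) (by simpa using hm 2) t
  rw [Measure.map_id, hc] at h
  simpa [charFun_walkMeasure, charFun_gaussianReal, neg_div] using h

lemma stdphi_eq_gaussianPDFReal (t : ℝ) : stdphi t = gaussianPDFReal 0 1 t := by
  simp [stdphi, gaussianPDFReal, div_eq_inv_mul]

lemma continuous_stdphi : Continuous stdphi := by
  unfold stdphi
  fun_prop

lemma integrable_stdphi : Integrable stdphi := by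
  rw [show stdphi = gaussianPDFReal 0 1 from funext stdphi_eq_gaussianPDFReal]
  exact integrable_gaussianPDFReal 0 1

lemma gaussianReal_real_Iic (t : ℝ) : (gaussianReal 0 1).real (Set.Iic t) = stdPhi t := by
  rw [measureReal_def, gaussianReal_apply_eq_integral 0 one_ne_zero, ENNReal.toReal_ofReal
    (integral_nonneg fun x => gaussianPDFReal_nonneg _ _ _), stdPhi]
  simp_rw [stdphi_eq_gaussianPDFReal]

lemma nullSingletonClass_stdGaussian : NullSingletonClass (gaussianReal 0 1) :=
  nullSingletonClass_gaussianReal one_ne_zero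

lemma gaussianReal_real_Ici (t : ℝ) : (gaussianReal 0 1).real (Set.Ici t) = 1 - stdPhi t := by
  have := nullSingletonClass_stdGaussian
  rw [← gaussianReal_real_Iic, ← measureReal_congr (Iio_ae_eq_Iic (a := t)),
    ← probReal_compl_eq_one_sub measurableSet_Iio, Set.compl_Iio]

lemma hasDerivAt_stdPhi (t : ℝ) : HasDerivAt stdPhi (stdphi t) t := by
  have h : stdPhi = fun t => stdPhi 0 + ∫ u in (0 : ℝ)..t, stdphi u := by
    ext t
    rw [← intervalIntegral.integral_Iic_sub_Iic integrable_stdphi.integrableOn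
      integrable_stdphi.integrableOn, stdPhi, stdPhi]
    ring
  rw [h]
  exact (intervalIntegral.integral_hasDerivAt_right (continuous_stdphi.intervalIntegrable _ _)
    (continuous_stdphi.stronglyMeasurableAtFilter _ _) continuous_stdphi.continuousAt).const_add _

lemma continuous_stdPhi : Continuous stdPhi :=
  continuous_iff_continuousAt.2 fun t => (hasDerivAt_stdPhi t).continuousAt

lemma stdPhi_neg (t : ℝ) : stdPhi (-t) = 1 - stdPhi t := by
  have h : stdPhi (-t) = ∫ u in Set.Ioi t, stdphi u := by
    rw [stdPhi, ← neg_neg t, ← integral_comp_neg_Iic, neg_neg]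
    simp [stdphi]
  have := nullSingletonClass_stdGaussian
  rw [h, ← gaussianReal_real_Ici, ← measureReal_congr (Ioi_ae_eq_Ici (a := t)), measureReal_def,
    gaussianReal_apply_eq_integral 0 one_ne_zero, ENNReal.toReal_ofReal
    (integral_nonneg fun x => gaussianPDFReal_nonneg _ _ _)]
  simp_rw [stdphi_eq_gaussianPDFReal]

lemma stdPhi_zero : stdPhi 0 = 1 / 2 := by
  have := stdPhi_neg 0
  rw [neg_zero] at this
  linarith

lemma gaussianReal_real_Icc {t : ℝ} (ht : 0 ≤ t) :
    (gaussianReal 0 1).real (Set.Icc (-t) t) = 2 * stdPhi t - 1 := by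
  have := nullSingletonClass_stdGaussian
  rw [← measureReal_congr (Ioc_ae_eq_Icc (a := -t) (b := t)), ← Set.Iic_sdiff_Iic,
    measureReal_sdiff (Set.Iic_subset_Iic.2 (by linarith)) measurableSet_Iic,
    gaussianReal_real_Iic, gaussianReal_real_Iic, stdPhi_neg]
  ring

lemma integral_limit_density (x : ℝ) :
    ∫ t in (0 : ℝ)..x, 4 * stdphi t * (2 * stdPhi t - 1) = (2 * stdPhi x - 1) ^ 2 := by
  have hd (t : ℝ) : HasDerivAt (fun t => (2 * stdPhi t - 1) ^ 2)
      (4 * stdphi t * (2 * stdPhi t - 1)) t := by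
    have h := (((hasDerivAt_stdPhi t).const_mul 2).sub_const 1).pow 2
    refine h.congr_deriv ?_
    push_cast
    ring
  have hc : Continuous fun t => 4 * stdphi t * (2 * stdPhi t - 1) := by
    have := continuous_stdphi
    have := continuous_stdPhi
    fun_prop
  rw [intervalIntegral.integral_eq_sub_of_hasDerivAt (fun t _ => hd t)
    (hc.intervalIntegrable _ _), stdPhi_zero]
  ring

/-- The standard half-normal distribution. -/
noncomputable def halfNormal : ProbabilityMeasure ℝ :=
  stdNormal.map (f := fun x => |x|) (by fun_prop)

lemma halfNormal_real_Iic {t : ℝ} (ht : 0 ≤ t) :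
    (halfNormal : Measure ℝ).real (Set.Iic t) = 2 * stdPhi t - 1 := by
  rw [← gaussianReal_real_Icc ht]
  change ((gaussianReal 0 1).map _).real _ = _
  rw [map_measureReal_apply (by fun_prop) measurableSet_Iic]
  congr 1
  ext x
  simp [abs_le]

lemma halfNormal_real_Iic_of_neg {t : ℝ} (ht : t < 0) :
    (halfNormal : Measure ℝ).real (Set.Iic t) = 0 := by
  change ((gaussianReal 0 1).map _).real _ = _
  rw [map_measureReal_apply (by fun_prop) measurableSet_Iic,
    show (fun x : ℝ => |x|) ⁻¹' Set.Iic t = ∅ from ?_, measureReal_empty]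
  ext x
  simpa using ht.trans_le (abs_nonneg x)

/-- The law of the sum of two independent half-normal variables. -/
noncomputable def halfNormalSum : ProbabilityMeasure ℝ :=
  (halfNormal.prod halfNormal).map (f := fun z => z.1 + z.2) (by fun_prop)

lemma halfNormalSum_apply {A : Set ℝ} (hA : MeasurableSet A) :
    (halfNormalSum : Measure ℝ) A =
      ((gaussianReal 0 1).prod (gaussianReal 0 1)) {z | |z.1| + |z.2| ∈ A} := by
  change ((((gaussianReal 0 1).map fun x => |x|).prod
    ((gaussianReal 0 1).map fun x => |x|)).map fun z : ℝ × ℝ => z.1 + z.2) A = _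
  rw [Measure.map_prod_map _ _ (by fun_prop) (by fun_prop),
    Measure.map_map (by fun_prop) (by fun_prop), Measure.map_apply (by fun_prop) hA]
  rfl

lemma halfNormalSum_singleton (c : ℝ) : (halfNormalSum : Measure ℝ) {c} = 0 := by
  have := nullSingletonClass_stdGaussian
  rw [halfNormalSum_apply (measurableSet_singleton c)]
  change ((gaussianReal 0 1).prod (gaussianReal 0 1))
    ((fun z : ℝ × ℝ => |z.1| + |z.2|) ⁻¹' {c}) = 0
  rw [Measure.measure_prod_null
    (measurableSet_preimage (f := fun z : ℝ × ℝ => |z.1| + |z.2|) (by fun_prop)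
      (measurableSet_singleton c))]
  refine ae_of_all _ fun a => ?_
  refine measure_mono_null (t := {c - |a|, -(c - |a|)}) ?_ (Set.Finite.measure_zero (by simp) _)
  intro b hb
  have hb : |a| + |b| = c := hb
  rcases abs_choice b with h | h
  · left; linarith
  · right; simp; linarith

lemma halfNormalSum_real_Iic {x : ℝ} (hx : 0 ≤ x) :
    (halfNormalSum : Measure ℝ).real (Set.Iic (√2 * x)) = (2 * stdPhi x - 1) ^ 2 := by
  rw [measureReal_def, halfNormalSum_apply measurableSet_Iic, sq, ← gaussianReal_real_Icc hx,
    ← measureReal_prod_prod, measureReal_def]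
  congr 1
  have hrot : ((gaussianReal 0 1).prod (gaussianReal 0 1)).map
      (ContinuousLinearMap.rotation (E := ℝ) (Real.pi / 4)) =
      (gaussianReal 0 1).prod (gaussianReal 0 1) := by
    exact IsGaussian.map_rotation_eq_self (by simp [integral_id_gaussianReal]) _
  conv_rhs => rw [← hrot]
  rw [Measure.map_apply (by fun_prop) (measurableSet_Icc.prod measurableSet_Icc)]
  congr 1
  ext ⟨a, b⟩
  have h2 : 0 < √(2 : ℝ) := by positivity
  have h3 : √(2 : ℝ) * √2 = 2 := by norm_num
  have key (u : ℝ) : |√2 / 2 * u| ≤ x ↔ |u| ≤ √2 * x := by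
    rw [abs_mul, abs_of_pos (by positivity), ← mul_le_mul_iff_right₀ h2, ← mul_assoc,
      ← mul_div_assoc, h3, div_self two_ne_zero, one_mul]
  have e1 : √2 / 2 * a + √2 / 2 * b = √2 / 2 * (a + b) := by ring
  have e2 : -(√2 / 2 * a) + √2 / 2 * b = √2 / 2 * (b - a) := by ring
  simp only [Set.mem_ofPred_eq, Set.mem_Iic, Set.mem_preimage, Set.mem_prod,
    ContinuousLinearMap.rotation_apply, Real.cos_pi_div_four, Real.sin_pi_div_four, smul_eq_mul,
    Set.mem_Icc, neg_mul, e1, e2]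
  rw [← abs_le, ← abs_le, key, key, abs_le, abs_le]
  rcases abs_cases a with h | h <;> rcases abs_cases b with h' | h' <;>
    exact ⟨fun H => ⟨⟨by linarith, by linarith⟩, by linarith, by linarith⟩,
      fun H => by linarith [H.1.1, H.1.2, H.2.1, H.2.2]⟩

lemma tendsto_measureReal_of_null_frontier {μs : ℕ → ProbabilityMeasure ℝ}
    {μ : ProbabilityMeasure ℝ} (h : Tendsto μs atTop (𝓝 μ)) {E : Set ℝ}
    (hE : (μ : Measure ℝ) (frontier E) = 0) :
    Tendsto (fun n => (μs n : Measure ℝ).real E) atTop (𝓝 ((μ : Measure ℝ).real E)) :=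
  (ENNReal.tendsto_toReal (measure_ne_top _ _)).comp
    (ProbabilityMeasure.tendsto_measure_of_null_frontier_of_tendsto' h hE)

lemma binomialTail_eq_walkMeasure {m : ℕ} (hm : 0 < m) (c : ℕ) :
    binomialTail m c = (walkMeasure m).real (Set.Ici ((√m)⁻¹ * (2 * c - m))) := by
  have hm' : 0 < (√m)⁻¹ := by positivity
  rw [walkMeasure, discreteMeasure_real (fun _ _ => by positivity) measurableSet_Ici, binomialTail]
  refine Finset.sum_congr rfl fun j _ => if_congr ?_ rfl rfl
  rw [Set.mem_Ici, mul_le_mul_iff_right₀ hm', sub_le_sub_iff_right,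
    mul_le_mul_iff_right₀ two_pos, Nat.cast_le]

lemma tendsto_walkMeasure_Ici {m : ℕ → ℕ} (hm : Tendsto m atTop atTop) (y : ℝ) :
    Tendsto (fun n => (walkMeasure (m n)).real (Set.Ici y)) atTop (𝓝 (1 - stdPhi y)) := by
  have := nullSingletonClass_stdGaussian
  rw [← gaussianReal_real_Ici]
  refine tendsto_measureReal_of_null_frontier (tendsto_walkLaw.comp hm) ?_
  rw [frontier_Ici]
  exact measure_singleton (μ := gaussianReal 0 1) y

lemma tendsto_binomialTail {m c : ℕ → ℕ} (hm : Tendsto m atTop atTop) {y : ℝ}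
    (hy : Tendsto (fun n => (√(m n))⁻¹ * (2 * c n - m n)) atTop (𝓝 y)) :
    Tendsto (fun n => binomialTail (m n) (c n)) atTop (𝓝 (1 - stdPhi y)) := by
  have hΦ : Continuous fun t => 1 - stdPhi t := continuous_const.sub continuous_stdPhi
  have hpos : ∀ᶠ n in atTop, 0 < m n := hm.eventually_gt_atTop 0
  refine tendsto_order.2 ⟨fun a ha => ?_, fun a ha => ?_⟩
  · obtain ⟨z, hyz, hz⟩ := (((hΦ.continuousAt.eventually (lt_mem_nhds ha)).filter_mono
      nhdsWithin_le_nhds).and (self_mem_nhdsWithin (s := Set.Ioi y))).exists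
    filter_upwards [hpos, (tendsto_walkMeasure_Ici hm z).eventually (lt_mem_nhds hyz),
      hy.eventually (gt_mem_nhds hz)] with n h0 h1 h2
    rw [binomialTail_eq_walkMeasure h0]
    exact h1.trans_le (measureReal_mono (Set.Ici_subset_Ici.2 h2.le))
  · obtain ⟨z, hyz, hz⟩ := (((hΦ.continuousAt.eventually (gt_mem_nhds ha)).filter_mono
      nhdsWithin_le_nhds).and (self_mem_nhdsWithin (s := Set.Iio y))).exists
    filter_upwards [hpos, (tendsto_walkMeasure_Ici hm z).eventually (gt_mem_nhds hyz),
      hy.eventually (lt_mem_nhds hz)] with n h0 h1 h2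
    rw [binomialTail_eq_walkMeasure h0]
    exact (measureReal_mono (Set.Ici_subset_Ici.2 h2.le)).trans_lt h1

/-- If `u` is within a bounded distance of `k` and `k / √N → y`, then `u / √N → y`. -/
lemma tendsto_div_sqrt_of_abs_sub_le {N : ℕ → ℕ} (hN : Tendsto N atTop atTop) {k u : ℕ → ℝ}
    {C y : ℝ} (hk : Tendsto (fun n => k n / √(N n)) atTop (𝓝 y))
    (hu : ∀ᶠ n in atTop, |u n - k n| ≤ C) :
    Tendsto (fun n => u n / √(N n)) atTop (𝓝 y) := by
  have hs : Tendsto (fun n => √(N n)) atTop atTop :=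
    Real.tendsto_sqrt_atTop.comp (tendsto_natCast_atTop_atTop.comp hN)
  have h0 : Tendsto (fun n => (u n - k n) / √(N n)) atTop (𝓝 0) := by
    refine squeeze_zero_norm' ?_ (hs.const_div_atTop C)
    filter_upwards [hu] with n hn
    rw [Real.norm_eq_abs, abs_div, abs_of_nonneg (Real.sqrt_nonneg _)]
    gcongr
  have := hk.add h0
  rw [add_zero] at this
  refine this.congr fun n => ?_
  ring

lemma tendsto_binomialTail_of_near {N k m c : ℕ → ℕ} (hN : Tendsto N atTop atTop) {y : ℝ}
    (hk : Tendsto (fun n => (k n : ℝ) / √(N n)) atTop (𝓝 y))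
    (hm : ∀ᶠ n in atTop, m n ≤ N n ∧ N n ≤ m n + k n + 1)
    (hc : ∀ᶠ n in atTop, k n + m n + 2 ≤ 2 * c n ∧ 2 * c n ≤ k n + m n + 3) :
    Tendsto (fun n => binomialTail (m n) (c n)) atTop (𝓝 (1 - stdPhi y)) := by
  have hs : Tendsto (fun n => √(N n)) atTop atTop :=
    Real.tendsto_sqrt_atTop.comp (tendsto_natCast_atTop_atTop.comp hN)
  have hratio : Tendsto (fun n => (m n : ℝ) / N n) atTop (𝓝 1) := by
    have h1 : Tendsto (fun n => ((k n + 1 : ℝ) / √(N n)) / √(N n)) atTop (𝓝 0) :=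
      (tendsto_div_sqrt_of_abs_sub_le (C := 1) hN hk (by simp)).div_atTop hs
    have h2 : Tendsto (fun n => 1 - ((k n + 1 : ℝ) / √(N n)) / √(N n)) atTop (𝓝 1) := by
      simpa using h1.const_sub 1
    refine tendsto_of_tendsto_of_tendsto_of_le_of_le' h2 tendsto_const_nhds ?_ ?_
    · filter_upwards [hm, hN.eventually_gt_atTop 0] with n hn h0
      have h0 : (0 : ℝ) < N n := by exact_mod_cast h0
      have hn : (N n : ℝ) ≤ m n + k n + 1 := by exact_mod_cast hn.2
      rw [div_div, Real.mul_self_sqrt h0.le, sub_le_iff_le_add, ← add_div, le_div_iff₀ h0]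
      linarith
    · filter_upwards [hm] with n hn
      exact div_le_one_of_le₀ (by exact_mod_cast hn.1) (by positivity)
  have hm_top : Tendsto m atTop atTop := by
    have := hratio.pos_mul_atTop one_pos (tendsto_natCast_atTop_atTop.comp hN)
    rw [← tendsto_natCast_atTop_iff (R := ℝ)]
    refine this.congr' ?_
    filter_upwards [hN.eventually_gt_atTop 0] with n h0
    have h0 : (0 : ℝ) < N n := by exact_mod_cast h0
    simp [h0.ne']
  refine tendsto_binomialTail hm_top ?_
  have h3 : Tendsto (fun n => (2 * c n - m n : ℝ) / √(N n)) atTop (𝓝 y) := by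
    refine tendsto_div_sqrt_of_abs_sub_le (C := 3) hN hk ?_
    filter_upwards [hc] with n hn
    have h1 : (k n + m n + 2 : ℝ) ≤ 2 * c n := by exact_mod_cast hn.1
    have h2 : (2 * c n : ℝ) ≤ k n + m n + 3 := by exact_mod_cast hn.2
    rw [abs_le]
    constructor <;> linarith
  have h4 := h3.div (hratio.sqrt) (by simp)
  rw [Real.sqrt_one, div_one] at h4
  refine h4.congr' ?_
  filter_upwards [hN.eventually_gt_atTop 0] with n h0
  have h0 : (0 : ℝ) < √(N n) := Real.sqrt_pos.2 (by exact_mod_cast h0)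
  rw [Pi.div_apply, Real.sqrt_div (Nat.cast_nonneg _), div_div_div_cancel_right₀ h0.ne',
    div_eq_inv_mul]

lemma tendsto_coeffTail_packetPoly {N k : ℕ → ℕ} (hN : Tendsto N atTop atTop) {y : ℝ}
    (hk : Tendsto (fun n => (k n : ℝ) / √(N n)) atTop (𝓝 y)) :
    Tendsto (fun n => coeffTail (packetPoly (N n)) (k n + 2) / 2 ^ N n) atTop
      (𝓝 (2 - 2 * stdPhi y)) := by
  have hkN : ∀ᶠ n in atTop, k n + 1 ≤ N n := by
    have hs : Tendsto (fun n => √(N n)) atTop atTop :=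
      Real.tendsto_sqrt_atTop.comp (tendsto_natCast_atTop_atTop.comp hN)
    have h1 : Tendsto (fun n => ((k n + 1 : ℝ) / √(N n)) / √(N n)) atTop (𝓝 0) :=
      (tendsto_div_sqrt_of_abs_sub_le (C := 1) hN hk (by simp)).div_atTop hs
    filter_upwards [h1.eventually (gt_mem_nhds one_pos), hN.eventually_gt_atTop 0] with n hn h0
    have h0 : (0 : ℝ) < N n := by exact_mod_cast h0
    rw [div_div, Real.mul_self_sqrt h0.le, div_lt_one h0] at hn
    exact_mod_cast hn.le
  have h1 := tendsto_binomialTail_of_near (m := fun n => N n - (k n + 1))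
    (c := fun n => (N n + 2) / 2) hN hk
    (hkN.mono fun n hn => by omega) (hkN.mono fun n hn => by omega)
  have h2 := tendsto_binomialTail_of_near (m := fun n => N n - k n)
    (c := fun n => (N n + 3) / 2) hN hk
    (hkN.mono fun n hn => by omega) (hkN.mono fun n hn => by omega)
  have h3 := h1.add h2
  rw [show 1 - stdPhi y + (1 - stdPhi y) = 2 - 2 * stdPhi y by ring] at h3
  refine h3.congr' ?_
  filter_upwards [hkN] with n hn
  rw [coeffTail_packetPoly _ _ hn]

/-- The law on `ℝ` giving mass `[q^k] packetPoly N / 2 ^ N` to the point `k * s`. -/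
noncomputable def packetLaw (N : ℕ) (s : ℝ) : ProbabilityMeasure ℝ :=
  ⟨discreteMeasure (Finset.range ((packetPoly N).natDegree + 1))
    (fun k => (packetPoly N).coeff k / 2 ^ N) (fun k => k * s),
    isProbabilityMeasure_discreteMeasure
      (fun k _ => div_nonneg (packetPoly_coeff_nonneg N k) (by positivity)) (by
        have h := eval_one_packetPoly N
        rw [Polynomial.eval_eq_sum_range] at h
        rw [← Finset.sum_div, div_eq_one_iff_eq (by positivity), ← h]
        simp)⟩

lemma coe_packetLaw (N : ℕ) (s : ℝ) : (packetLaw N s : Measure ℝ) =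
    discreteMeasure (Finset.range ((packetPoly N).natDegree + 1))
      (fun k => (packetPoly N).coeff k / 2 ^ N) (fun k => k * s) := rfl

lemma packetLaw_real_Iic (N : ℕ) {s t : ℝ} (hs : 0 < s) (ht : 0 ≤ t) :
    (packetLaw N s : Measure ℝ).real (Set.Iic t) =
      1 - coeffTail (packetPoly N) (⌊t / s⌋₊ + 1) / 2 ^ N := by
  rw [coeffTail, eval_one_packetPoly, sub_div, div_self (by positivity), sub_sub_cancel,
    Finset.sum_div]
  rw [coe_packetLaw, discreteMeasure_real
    (fun k _ => div_nonneg (packetPoly_coeff_nonneg N k) (by positivity)) measurableSet_Iic]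
  have hmem (k : ℕ) : (k : ℝ) * s ∈ Set.Iic t ↔ k < ⌊t / s⌋₊ + 1 := by
    rw [Set.mem_Iic, ← le_div_iff₀ hs, ← Nat.le_floor_iff (by positivity), Nat.lt_succ_iff]
  simp only [hmem]
  rw [← Finset.sum_filter]
  refine Finset.sum_subset_zero_on_sdiff (fun k hk => ?_) (fun k hk => ?_) (fun _ _ => rfl)
  · exact Finset.mem_range.2 (Finset.mem_filter.1 hk).2
  · rw [Finset.mem_sdiff, Finset.mem_filter, Finset.mem_range, Finset.mem_range] at hk
    rw [Polynomial.coeff_eq_zero_of_natDegree_lt (by omega), zero_div]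

lemma packetLaw_real_Iic_of_neg (N : ℕ) {s t : ℝ} (hs : 0 < s) (ht : t < 0) :
    (packetLaw N s : Measure ℝ).real (Set.Iic t) = 0 := by
  rw [coe_packetLaw, discreteMeasure_real
    (fun k _ => div_nonneg (packetPoly_coeff_nonneg N k) (by positivity)) measurableSet_Iic]
  refine Finset.sum_eq_zero fun k _ => if_neg ?_
  rw [Set.mem_Iic, not_le]
  exact ht.trans_le (by positivity)

lemma tendsto_packetLaw_real_Iic_of_pos {N : ℕ → ℕ} {s : ℕ → ℝ} (hN : Tendsto N atTop atTop)
    (hs0 : ∀ᶠ n in atTop, 0 < s n) (hs : Tendsto (fun n => s n * √(N n)) atTop (𝓝 1)) {t : ℝ}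
    (ht : 0 < t) :
    Tendsto (fun n => (packetLaw (N n) (s n) : Measure ℝ).real (Set.Iic t)) atTop
      (𝓝 (2 * stdPhi t - 1)) := by
  have hsq : Tendsto (fun n => √(N n)) atTop atTop :=
    Real.tendsto_sqrt_atTop.comp (tendsto_natCast_atTop_atTop.comp hN)
  have hsmall : ∀ᶠ n in atTop, s n ≤ t := by
    have h := hs.div_atTop hsq
    filter_upwards [h.eventually (gt_mem_nhds ht), hN.eventually_gt_atTop 0] with n hn h0
    have h0 : (0 : ℝ) < √(N n) := Real.sqrt_pos.2 (by exact_mod_cast h0)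
    rw [mul_div_cancel_right₀ _ h0.ne'] at hn
    exact hn.le
  have hfloor : ∀ᶠ n in atTop, 1 ≤ ⌊t / s n⌋₊ := by
    filter_upwards [hsmall, hs0] with n h1 h2
    exact (Nat.one_le_floor_iff _).2 ((one_le_div h2).2 h1)
  have hk : Tendsto (fun n => ((⌊t / s n⌋₊ - 1 : ℕ) : ℝ) / √(N n)) atTop (𝓝 t) := by
    refine tendsto_div_sqrt_of_abs_sub_le (k := fun n => t / s n) (C := 2) hN ?_ ?_
    · have h := (tendsto_const_nhds (x := t)).div hs one_ne_zero
      rw [div_one] at h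
      refine h.congr fun n => ?_
      rw [Pi.div_apply, div_div]
    · filter_upwards [hfloor, hs0] with n h1 h2
      have h3 := Nat.floor_le (show 0 ≤ t / s n by positivity)
      have h4 := Nat.lt_floor_add_one (t / s n)
      rw [Nat.cast_sub h1, abs_le]
      push_cast
      constructor <;> linarith
  have h := (tendsto_coeffTail_packetPoly hN hk).const_sub 1
  rw [show 1 - (2 - 2 * stdPhi t) = 2 * stdPhi t - 1 by ring] at h
  refine h.congr' ?_
  filter_upwards [hfloor, hs0] with n h1 h2
  rw [packetLaw_real_Iic _ h2 ht.le, show ⌊t / s n⌋₊ - 1 + 2 = ⌊t / s n⌋₊ + 1 by omega]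

lemma tendsto_packetLaw_real_Iic {N : ℕ → ℕ} {s : ℕ → ℝ} (hN : Tendsto N atTop atTop)
    (hs0 : ∀ᶠ n in atTop, 0 < s n) (hs : Tendsto (fun n => s n * √(N n)) atTop (𝓝 1)) (t : ℝ) :
    Tendsto (fun n => (packetLaw (N n) (s n) : Measure ℝ).real (Set.Iic t)) atTop
      (𝓝 ((halfNormal : Measure ℝ).real (Set.Iic t))) := by
  rcases lt_trichotomy t 0 with ht | rfl | ht
  · rw [halfNormal_real_Iic_of_neg ht]
    refine tendsto_const_nhds.congr' ?_
    filter_upwards [hs0] with n hn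
    rw [packetLaw_real_Iic_of_neg _ hn ht]
  · rw [halfNormal_real_Iic le_rfl, stdPhi_zero, mul_one_div_cancel two_ne_zero, sub_self]
    refine tendsto_order.2 ⟨fun a ha => .of_forall fun n => ha.trans_le measureReal_nonneg,
      fun a ha => ?_⟩
    have hc : Continuous fun t => 2 * stdPhi t - 1 :=
      (continuous_const.mul continuous_stdPhi).sub continuous_const
    have ha' : 2 * stdPhi 0 - 1 < a := by rw [stdPhi_zero]; linarith
    obtain ⟨z, hza, hz⟩ := (((hc.continuousAt.eventually (gt_mem_nhds ha')).filter_mono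
      nhdsWithin_le_nhds).and (self_mem_nhdsWithin (s := Set.Ioi 0))).exists
    filter_upwards [(tendsto_packetLaw_real_Iic_of_pos hN hs0 hs hz).eventually
      (gt_mem_nhds hza)] with n hn
    exact (measureReal_mono (Set.Iic_subset_Iic.2 (le_of_lt hz))).trans_lt hn
  · rw [halfNormal_real_Iic ht.le]
    exact tendsto_packetLaw_real_Iic_of_pos hN hs0 hs ht

/-- Pointwise convergence of distribution functions implies weak convergence. -/
lemma tendsto_of_tendsto_measureReal_Iic {μs : ℕ → ProbabilityMeasure ℝ}
    {μ : ProbabilityMeasure ℝ}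
    (h : ∀ t, Tendsto (fun n => (μs n : Measure ℝ).real (Set.Iic t)) atTop
      (𝓝 ((μ : Measure ℝ).real (Set.Iic t)))) :
    Tendsto μs atTop (𝓝 μ) := by
  refine (isPiSystem_Ioc (id : ℝ → ℝ) id).tendsto_probabilityMeasure_of_tendsto_of_mem ?_ ?_ ?_
  · rintro _ ⟨a, b, -, rfl⟩
    exact measurableSet_Ioc
  · intro u hu x hx
    obtain ⟨a, b, hab, hsub⟩ := (mem_nhds_iff_exists_Ioo_subset.1 (hu.mem_nhds hx))
    obtain ⟨c, hxc, hcb⟩ := exists_between hab.2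
    exact ⟨Set.Ioc a c, ⟨a, c, hab.1.trans hxc, rfl⟩, Ioc_mem_nhds hab.1 hxc,
      fun y hy => hsub ⟨hy.1, hy.2.trans_lt hcb⟩⟩
  · rintro _ ⟨a, b, hab, rfl⟩
    rw [← NNReal.tendsto_coe]
    have key (ν : ProbabilityMeasure ℝ) : ((ν (Set.Ioc a b) : NNReal) : ℝ) =
        (ν : Measure ℝ).real (Set.Iic b) - (ν : Measure ℝ).real (Set.Iic a) := by
      rw [← measureReal_sdiff (Set.Iic_subset_Iic.2 (show a ≤ b from le_of_lt hab)) measurableSet_Iic,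
        Set.Iic_sdiff_Iic]
      rfl
    simp only [id, key]
    exact (h b).sub (h a)

lemma tendsto_packetLaw {N : ℕ → ℕ} {s : ℕ → ℝ} (hN : Tendsto N atTop atTop)
    (hs0 : ∀ᶠ n in atTop, 0 < s n) (hs : Tendsto (fun n => s n * √(N n)) atTop (𝓝 1)) :
    Tendsto (fun n => packetLaw (N n) (s n)) atTop (𝓝 halfNormal) :=
  tendsto_of_tendsto_measureReal_Iic fun t => tendsto_packetLaw_real_Iic hN hs0 hs t

lemma tsum_ite_coeff (p : Polynomial ℝ) {c : ℝ} (hc : 0 ≤ c) :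
    ∑' k : ℕ, (if (k : ℝ) ≤ c then p.coeff k else 0) =
      ∑ k ∈ Finset.range (⌊c⌋₊ + 1), p.coeff k := by
  rw [tsum_eq_sum (s := Finset.range (⌊c⌋₊ + 1))]
  · refine Finset.sum_congr rfl fun k hk => if_pos ?_
    rwa [← Nat.le_floor_iff hc, ← Nat.lt_succ_iff, ← Finset.mem_range]
  · intro k hk
    rw [if_neg]
    rwa [← Nat.le_floor_iff hc, ← Nat.lt_succ_iff, Nat.succ_eq_add_one, ← Finset.mem_range]

lemma sum_range_coeff_mul (p r : Polynomial ℝ) (M : ℕ) :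
    ∑ k ∈ Finset.range M, (p * r).coeff k =
      ∑ i ∈ Finset.range (p.natDegree + 1), ∑ j ∈ Finset.range (r.natDegree + 1),
        if i + j < M then p.coeff i * r.coeff j else 0 := by
  conv_lhs => rw [p.as_sum_range, r.as_sum_range, Finset.sum_mul_sum]
  simp only [Polynomial.finsetSum_coeff, Polynomial.monomial_mul_monomial,
    Polynomial.coeff_monomial]
  rw [Finset.sum_comm]
  refine Finset.sum_congr rfl fun i _ => ?_
  rw [Finset.sum_comm]
  refine Finset.sum_congr rfl fun j _ => ?_
  simp

/-- The law of the sum of two independent rescaled packet contributions, for packets of sizes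
`⌈n / 2⌉` and `⌊n / 2⌋`. -/
noncomputable def packetSumLaw (n : ℕ) : ProbabilityMeasure ℝ :=
  ((packetLaw ((n + 1) / 2) (√2 / √n)).prod (packetLaw (n - (n + 1) / 2) (√2 / √n))).map
    (f := fun z => z.1 + z.2) (by fun_prop)

lemma packetSumLaw_real_Iic {n : ℕ} (hn : 0 < n) {x : ℝ} (hx : 0 ≤ x) :
    (packetSumLaw n : Measure ℝ).real (Set.Iic (√2 * x)) =
      1 / 2 ^ n * ∑ k ∈ Finset.range (⌊x * √n⌋₊ + 1),
        (packetPoly ((n + 1) / 2) * packetPoly (n - (n + 1) / 2)).coeff k := by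
  have hmeas : Measurable fun z : ℝ × ℝ => z.1 + z.2 := by fun_prop
  have hn' : 0 < √(n : ℝ) := by positivity
  change ((((packetLaw ((n + 1) / 2) (√2 / √n) : Measure ℝ).prod
    (packetLaw (n - (n + 1) / 2) (√2 / √n) : Measure ℝ))).map fun z : ℝ × ℝ => z.1 + z.2).real _ = _
  rw [map_measureReal_apply hmeas measurableSet_Iic, coe_packetLaw, coe_packetLaw,
    discreteMeasure_prod_real
      (fun k _ => div_nonneg (packetPoly_coeff_nonneg _ k) (by positivity))
      (fun k _ => div_nonneg (packetPoly_coeff_nonneg _ k) (by positivity))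
      (hmeas measurableSet_Iic), sum_range_coeff_mul]
  have hmem (i j : ℕ) : ((i * (√2 / √n), j * (√2 / √n)) : ℝ × ℝ) ∈
      (fun z : ℝ × ℝ => z.1 + z.2) ⁻¹' Set.Iic (√2 * x) ↔ i + j < ⌊x * √n⌋₊ + 1 := by
    have h2 : 0 < √(2 : ℝ) := by positivity
    rw [Nat.lt_succ_iff, Nat.le_floor_iff (by positivity), ← div_le_iff₀ hn', Set.mem_preimage,
      Set.mem_Iic, ← mul_le_mul_iff_right₀ (b := ((i + j : ℕ) : ℝ) / √n) h2]
    refine Eq.to_iff (congrArg (· ≤ √2 * x) ?_)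
    push_cast
    ring
  simp only [hmem, Finset.mul_sum]
  refine Finset.sum_congr rfl fun i _ => Finset.sum_congr rfl fun j _ => ?_
  have hpow : (2 : ℝ) ^ n = 2 ^ ((n + 1) / 2) * 2 ^ (n - (n + 1) / 2) := by
    rw [← pow_add]
    congr 1
    omega
  rw [mul_ite, mul_zero, hpow]
  congr 1
  field_simp

lemma tendsto_scale_mul_sqrt {N : ℕ → ℕ} (hN : ∀ n, n ≤ 2 * N n + 1 ∧ 2 * N n ≤ n + 1) :
    Tendsto (fun n : ℕ => √2 / √n * √(N n)) atTop (𝓝 1) := by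
  have hdiff : Tendsto (fun n : ℕ => (2 * N n - n : ℝ) / n) atTop (𝓝 0) := by
    refine squeeze_zero_norm (fun n => ?_) (tendsto_const_div_atTop_nhds_zero_nat 1)
    have h1 : (n : ℝ) ≤ 2 * N n + 1 := by exact_mod_cast (hN n).1
    have h2 : (2 * N n : ℝ) ≤ n + 1 := by exact_mod_cast (hN n).2
    rw [Real.norm_eq_abs, abs_div, Nat.abs_cast]
    gcongr
    rw [abs_le]
    constructor <;> linarith
  have h := (hdiff.const_add 1).sqrt
  rw [add_zero, Real.sqrt_one] at h
  refine h.congr' ?_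
  filter_upwards [eventually_gt_atTop 0] with n hn
  have hn : (0 : ℝ) < n := by exact_mod_cast hn
  rw [← Real.sqrt_div zero_le_two, ← Real.sqrt_mul (by positivity)]
  congr 1
  field_simp
  ring

lemma tendsto_packetSumLaw : Tendsto packetSumLaw atTop (𝓝 halfNormalSum) := by
  have hs0 : ∀ᶠ n : ℕ in atTop, 0 < √2 / √(n : ℝ) := by
    filter_upwards [eventually_gt_atTop 0] with n hn
    positivity
  have h1 : Tendsto (fun n : ℕ => packetLaw ((n + 1) / 2) (√2 / √n)) atTop (𝓝 halfNormal) :=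
    tendsto_packetLaw (tendsto_atTop_mono (f := fun n => n / 2) (fun n => by omega)
      (Nat.tendsto_div_const_atTop two_ne_zero)) hs0 (tendsto_scale_mul_sqrt fun n => by omega)
  have h2 : Tendsto (fun n : ℕ => packetLaw (n - (n + 1) / 2) (√2 / √n)) atTop (𝓝 halfNormal) :=
    tendsto_packetLaw (tendsto_atTop_mono (f := fun n => n / 2) (fun n => by omega)
      (Nat.tendsto_div_const_atTop two_ne_zero)) hs0 (tendsto_scale_mul_sqrt fun n => by omega)
  exact ProbabilityMeasure.tendsto_map_of_tendsto_of_continuous _ _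
    ((ProbabilityMeasure.continuous_prod.tendsto (halfNormal, halfNormal)).comp
      (h1.prodMk_nhds h2)) (by fun_prop)

lemma fP_eq (n : ℕ) :
    fP n = 4 * Polynomial.X ^ 4 - 2 * (Polynomial.X ^ 2 + Polynomial.X ^ 3) +
      packetPoly ((n + 1) / 2) * packetPoly (n - (n + 1) / 2) := by
  rw [fP, packetPoly, packetPoly, Finset.sum_mul_sum]

lemma abs_sum_range_coeff_correction_le (M : ℕ) :
    |∑ k ∈ Finset.range M, (4 * Polynomial.X ^ 4 -
      2 * (Polynomial.X ^ 2 + Polynomial.X ^ 3) : Polynomial ℝ).coeff k| ≤ 8 := by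
  have h4 : (4 : Polynomial ℝ) = Polynomial.C 4 := rfl
  have h2 : (2 : Polynomial ℝ) = Polynomial.C 2 := rfl
  simp only [h4, h2, Polynomial.coeff_sub, Polynomial.coeff_C_mul, Polynomial.coeff_add,
    Polynomial.coeff_X_pow, Finset.sum_sub_distrib, ← Finset.mul_sum, Finset.sum_add_distrib,
    Finset.sum_ite_eq', Finset.mem_range]
  split_ifs <;> norm_num

theorem stmt9 (x : ℝ) (hx : 0 ≤ x) :
    Tendsto (fun n : ℕ =>
        (1 / 2 ^ n : ℝ) *
          ∑' k : ℕ, if (k : ℝ) ≤ x * Real.sqrt n then (fP n).coeff k else 0)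
      atTop (nhds (∫ t in (0 : ℝ)..x, 4 * stdphi t * (2 * stdPhi t - 1))) := by
  have hmain := tendsto_measureReal_of_null_frontier tendsto_packetSumLaw (E := Set.Iic (√2 * x))
    (by rw [frontier_Iic]; exact halfNormalSum_singleton _)
  rw [halfNormalSum_real_Iic hx, ← integral_limit_density] at hmain
  have hcorr : Tendsto (fun n : ℕ => (1 / 2 ^ n : ℝ) *
      ∑ k ∈ Finset.range (⌊x * √n⌋₊ + 1), (4 * Polynomial.X ^ 4 -
        2 * (Polynomial.X ^ 2 + Polynomial.X ^ 3) : Polynomial ℝ).coeff k) atTop (𝓝 0) := by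
    have h := (tendsto_pow_atTop_nhds_zero_of_lt_one (r := (1 / 2 : ℝ)) (by norm_num)
      (by norm_num)).mul_const 8
    rw [zero_mul] at h
    refine squeeze_zero_norm (fun n => ?_) h
    rw [norm_mul, one_div_pow, Real.norm_of_nonneg (by positivity), Real.norm_eq_abs]
    gcongr
    exact abs_sum_range_coeff_correction_le _
  have h := hcorr.add hmain
  rw [zero_add] at h
  refine h.congr' ?_
  filter_upwards [eventually_gt_atTop 0] with n hn
  rw [packetSumLaw_real_Iic hn hx, tsum_ite_coeff _ (by positivity), fP_eq, ← mul_add,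
    ← Finset.sum_add_distrib]
  simp only [Polynomial.coeff_add]
end

section
/- Let t > 0 and let (m1(ν)), (m2(ν)) be sequences of nonnegative integers with m1(ν) → ∞ and (m1(ν) − m2(ν))/√(m1(ν)) → t as ν → ∞. Then for every real z ≥ 0, P(Y_{m1,m2} ≤ z·√(m1)) = (Σ_{0 ≤ k ≤ z·√(m1(ν))} [q^k] g_{m1(ν),m2(ν)}(q)) / binom(m1(ν)+m2(ν), m1(ν)) converges to 1 − e^{−z(2t+z)/4}; that is, Y_{m1,m2}/√(m1) converges in distribution to a linear exponential distribution LinExp(t/2, 1/2). -/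
open Filter

/-- The sum of the coefficients of `p` of degree less than `k`. -/
noncomputable def partialCoeffSum (p : Polynomial ℝ) (k : ℕ) : ℝ :=
  ∑ j ∈ Finset.range k, p.coeff j

lemma partialCoeffSum_add (p r : Polynomial ℝ) (k : ℕ) :
    partialCoeffSum (p + r) k = partialCoeffSum p k + partialCoeffSum r k := by
  simp [partialCoeffSum, Finset.sum_add_distrib]

lemma partialCoeffSum_X_mul (p : Polynomial ℝ) (k : ℕ) :
    partialCoeffSum (Polynomial.X * p) k = partialCoeffSum p (k - 1) := by
  cases k with
  | zero => simp [partialCoeffSum]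
  | succ k => simp [partialCoeffSum, Finset.sum_range_succ', Polynomial.coeff_X_mul]

lemma partialCoeffSum_X_pow_ite_mul (c : Prop) [Decidable c] (p : Polynomial ℝ) (k : ℕ) :
    partialCoeffSum (Polynomial.X ^ (if c then 1 else 0) * p) k
      = partialCoeffSum p (if c then k - 1 else k) := by
  split_ifs <;> simp [partialCoeffSum_X_mul]

/-- The sum of the coefficients of `gP m1 m2` of degree at least `k`, in closed form. -/
noncomputable def gPTail (m1 m2 : ℕ) : ℕ → ℝ
  | 0 => ((m1 + m2).choose m1 : ℝ)
  | k + 1 =>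
    if m1 ≤ m2 then 2 ^ k * ((m1 + m2 - k).choose (m2 + 1) : ℝ)
    else if m1 = m2 + 1 then 2 ^ k * ((m1 + m2 - k).choose m1 : ℝ)
    else 2 ^ (k - 1) * ((m1 + m2 - (k - 1)).choose m1 : ℝ)

lemma choose_succ_sub_eq_add (n k r : ℕ) (hr : r ≠ 0) :
    ((n + 1 - k).choose (r + 1) : ℝ) = (n - k).choose r + (n - k).choose (r + 1) := by
  rcases le_or_gt k n with h | h
  · rw [Nat.succ_sub h, Nat.succ_eq_add_one, Nat.choose_succ_succ]
    push_cast
    ring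
  · have h1 : n + 1 - k = 0 := by omega
    have h2 : n - k = 0 := by omega
    obtain ⟨r, rfl⟩ := Nat.exists_eq_succ_of_ne_zero hr
    simp [h1, h2]

lemma gPTail_zero_succ (m2 k : ℕ) : gPTail 0 (m2 + 1) k = gPTail 0 m2 k := by
  cases k with
  | zero => simp [gPTail]
  | succ k =>
    have h1 : m2 + 1 - k < m2 + 2 := by omega
    have h2 : m2 - k < m2 + 1 := by omega
    simp [gPTail, Nat.choose_eq_zero_of_lt h1, Nat.choose_eq_zero_of_lt h2]

lemma gPTail_succ_of_add_two_le {m1 m2 : ℕ} (h : m2 + 2 ≤ m1) (k : ℕ) :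
    gPTail m1 m2 (k + 1) = 2 ^ (k - 1) * ((m1 + m2 - (k - 1)).choose m1 : ℝ) := by
  rw [gPTail, if_neg (by omega), if_neg (by omega)]

lemma gPTail_succ_of_eq_add_one (m2 k : ℕ) :
    gPTail (m2 + 1) m2 (k + 1) = 2 ^ k * ((m2 + 1 + m2 - k).choose (m2 + 1) : ℝ) := by
  simp [gPTail]

lemma gPTail_succ_of_le {m1 m2 : ℕ} (h : m1 ≤ m2) (k : ℕ) :
    gPTail m1 m2 (k + 1) = 2 ^ k * ((m1 + m2 - k).choose (m2 + 1) : ℝ) := by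
  rw [gPTail, if_pos h]

lemma choose_succ_sub_succ_self (m k : ℕ) (hm : m ≠ 0) :
    (m + 1 - k).choose (m + 1) = (m - k).choose m := by
  have h : m - k < m + 1 := by omega
  have := choose_succ_sub_eq_add m k m hm
  rw [Nat.choose_eq_zero_of_lt h, Nat.cast_zero, add_zero] at this
  exact_mod_cast this

lemma gPTail_succ_zero (m1 k : ℕ) :
    gPTail (m1 + 1) 0 k
      = gPTail m1 0 (if (m1 + 1) / 2 + 1 = m1 + 1 then k - 1 else k) := by
  obtain _ | _ | m1 := m1
  · obtain _ | _ | k := k <;> simp [gPTail]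
  · obtain _ | _ | k := k
    · simp [gPTail]
    · simp [gPTail]
    · have h := choose_succ_sub_succ_self 1 k one_ne_zero
      simpa [gPTail] using h
  · rw [if_neg (by omega)]
    obtain _ | k := k
    · simp [gPTail]
    · have h := choose_succ_sub_succ_self (m1 + 2) (k - 1) (by omega)
      rw [gPTail_succ_of_add_two_le (by omega)]
      obtain _ | m1 := m1
      all_goals
        rw [gPTail_succ_of_add_two_le (by omega)]
        simpa using h

lemma gPTail_succ_succ (m1 m2 k : ℕ) :
    gPTail (m1 + 1) (m2 + 1) k
      = gPTail m1 (m2 + 1) (if (m1 + 1 + (m2 + 1)) / 2 + 1 = m1 + 1 then k - 1 else k)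
        + gPTail (m1 + 1) m2 k := by
  have pascal (k : ℕ) {r : ℕ} (hr : r ≠ 0) :
      ((m1 + 1 + (m2 + 1) - k).choose (r + 1) : ℝ)
        = (m1 + (m2 + 1) - k).choose r + (m1 + 1 + m2 - k).choose (r + 1) := by
    have h := choose_succ_sub_eq_add (m1 + m2 + 1) k r hr
    rwa [show m1 + 1 + (m2 + 1) = m1 + m2 + 1 + 1 by ring,
      show m1 + (m2 + 1) = m1 + m2 + 1 by ring, show m1 + 1 + m2 = m1 + m2 + 1 by ring]
  have h_comm : m1 + (m2 + 1) = m1 + 1 + m2 := by ring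
  have hzero : gPTail (m1 + 1) (m2 + 1) 0 = gPTail m1 (m2 + 1) 0 + gPTail (m1 + 1) m2 0 := by
    simp only [gPTail]
    rw [show m1 + 1 + (m2 + 1) = (m1 + (m2 + 1)) + 1 by ring, Nat.choose_succ_succ,
      show m1 + 1 + m2 = m1 + (m2 + 1) by ring]
    push_cast
    ring
  obtain _ | k := k
  · simpa using hzero
  rcases lt_trichotomy m1 (m2 + 1) with h | rfl | h
  · rw [if_neg (by omega), gPTail_succ_of_le (by omega)]
    rcases Nat.lt_succ_iff_lt_or_eq.1 h with h' | rfl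
    · rw [gPTail_succ_of_le (by omega), gPTail_succ_of_le (by omega),
        pascal k m2.add_one_ne_zero, h_comm, mul_add, add_comm]
    · rw [gPTail_succ_of_le (by omega), gPTail_succ_of_eq_add_one,
        pascal k m1.add_one_ne_zero, h_comm, mul_add, add_comm]
  · rw [if_pos (by omega), gPTail_succ_of_eq_add_one,
      gPTail_succ_of_add_two_le (m1 := m2 + 1 + 1) le_rfl]
    obtain _ | k := k
    · simpa [gPTail] using hzero
    · have h1 : m2 + 1 + 1 + (m2 + 1) - (k + 1) = m2 + 1 + (m2 + 1) - k := by omega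
      have h2 : m2 + 1 + 1 + m2 - k = m2 + 1 + (m2 + 1) - k := by omega
      simp only [Nat.add_sub_cancel]
      rw [gPTail_succ_of_le le_rfl, h1, h2]
      ring
  · rw [gPTail_succ_of_add_two_le (by omega), gPTail_succ_of_add_two_le (by omega)]
    rcases Nat.succ_le_iff.2 h |>.eq_or_lt with rfl | h'
    · rw [if_pos (by omega), Nat.add_sub_cancel]
      obtain _ | k := k
      · simpa [gPTail] using hzero
      · rw [gPTail_succ_of_eq_add_one, Nat.add_sub_cancel, pascal k (by omega)]
        ring
    · rw [if_neg (by omega), gPTail_succ_of_add_two_le (by omega), pascal _ (by omega)]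
      ring

lemma partialCoeffSum_gP (m1 m2 k : ℕ) :
    partialCoeffSum (gP m1 m2) k = (m1 + m2).choose m1 - gPTail m1 m2 k := by
  induction m1, m2 using gP.induct generalizing k with
  | case1 =>
    cases k <;> simp [gP, gPTail, partialCoeffSum, Polynomial.coeff_one]
  | case2 m2 ih => rw [gP, ih, gPTail_zero_succ]; simp
  | case3 m1 ih => rw [gP, partialCoeffSum_X_pow_ite_mul, ih, gPTail_succ_zero]; simp
  | case4 m1 m2 ih1 ih2 =>
    rw [gP, partialCoeffSum_add, partialCoeffSum_X_pow_ite_mul, ih1, ih2, gPTail_succ_succ]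
    have h : ((m1 + 1 + (m2 + 1)).choose (m1 + 1) : ℝ)
        = (m1 + (m2 + 1)).choose m1 + (m1 + 1 + m2).choose (m1 + 1) := by
      rw [show m1 + 1 + (m2 + 1) = (m1 + (m2 + 1)) + 1 by ring, Nat.choose_succ_succ,
        show m1 + 1 + m2 = m1 + (m2 + 1) by ring]
      push_cast
      ring
    rw [h]
    ring

lemma tsum_ite_le_coeff (p : Polynomial ℝ) {x : ℝ} (hx : 0 ≤ x) :
    (∑' k : ℕ, if (k : ℝ) ≤ x then p.coeff k else 0) = partialCoeffSum p (⌊x⌋₊ + 1) := by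
  rw [tsum_eq_sum (s := Finset.range (⌊x⌋₊ + 1)), partialCoeffSum]
  · refine Finset.sum_congr rfl fun k hk => if_pos ?_
    rw [Finset.mem_range, Nat.lt_succ_iff] at hk
    exact (Nat.le_floor_iff hx).1 hk
  · intro k hk
    refine if_neg fun h => hk ?_
    rw [Finset.mem_range, Nat.lt_succ_iff]
    exact Nat.le_floor h

lemma two_pow_mul_choose_sub_eq_prod (a b j : ℕ) (hj : j ≤ b) :
    2 ^ j * ((a + b - j).choose a : ℝ)
      = (a + b).choose a
        * ∏ i ∈ Finset.range j, (2 * ((b : ℝ) - i) / ((a : ℝ) + b - i)) := by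
  induction j with
  | zero => simp
  | succ j ih =>
    rw [Finset.prod_range_succ, ← mul_assoc, ← ih (by omega)]
    obtain ⟨c, rfl⟩ : ∃ c, b = c + j + 1 := ⟨b - j - 1, by omega⟩
    have h := Nat.choose_mul_succ_eq (a + c) a
    have h1 : a + (c + j + 1) - (j + 1) = a + c := by omega
    have h2 : a + (c + j + 1) - j = a + c + 1 := by omega
    have h3 : a + c + 1 - a = c + 1 := by omega
    rw [h3] at h
    rw [h1, h2]
    have h' : ((a + c).choose a : ℝ) * (a + c + 1) = (a + c + 1).choose a * (c + 1) := by
      exact_mod_cast h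
    have h4 : ((a : ℝ) + ((c + j + 1 : ℕ) : ℝ) - j) = a + c + 1 := by push_cast; ring
    have h5 : (((c + j + 1 : ℕ) : ℝ) - j) = c + 1 := by push_cast; ring
    rw [h4, h5, ← mul_div_assoc, eq_div_iff (by positivity), pow_succ]
    linear_combination (2 ^ j * 2) * h'

lemma sum_range_add_cast (d : ℝ) (j : ℕ) :
    ∑ i ∈ Finset.range j, (d + i) = j * d + j * (j - 1) / 2 := by
  induction j with
  | zero => simp
  | succ j ih => rw [Finset.sum_range_succ, ih]; push_cast; ring

lemma prod_ratio_le_exp {a b j : ℕ} (hab : b ≤ a) (hj : j ≤ b) :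
    ∏ i ∈ Finset.range j, (2 * ((b : ℝ) - i) / ((a : ℝ) + b - i))
      ≤ Real.exp (-((j * ((a : ℝ) - b) + j * (j - 1) / 2) / (a + b))) := by
  rw [← sum_range_add_cast, Finset.sum_div, ← Finset.sum_neg_distrib, Real.exp_sum]
  have hab' : (b : ℝ) ≤ a := by exact_mod_cast hab
  refine Finset.prod_le_prod (fun i hi => ?_) fun i hi => ?_ <;>
    have hi' : (i : ℝ) + 1 ≤ b := by exact_mod_cast (Finset.mem_range.1 hi).trans_le hj
  · exact div_nonneg (by linarith) (by linarith)
  · have hi0 : (0 : ℝ) ≤ i := i.cast_nonneg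
    calc 2 * ((b : ℝ) - i) / ((a : ℝ) + b - i)
        = -((a - b + i) / ((a : ℝ) + b - i)) + 1 := by
          field_simp [show (a : ℝ) + b - i ≠ 0 by linarith]
          ring
      _ ≤ -((a - b + i) / ((a : ℝ) + b)) + 1 := by
          gcongr
          · linarith
          · linarith
      _ ≤ _ := Real.add_one_le_exp _

lemma exp_le_prod_ratio {a b j : ℕ} (hab : b ≤ a) (hj : j < b) :
    Real.exp (-((j * ((a : ℝ) - b) + j * (j - 1) / 2) / (2 * (b - j))))
      ≤ ∏ i ∈ Finset.range j, (2 * ((b : ℝ) - i) / ((a : ℝ) + b - i)) := by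
  rw [← sum_range_add_cast, Finset.sum_div, ← Finset.sum_neg_distrib, Real.exp_sum]
  have hab' : (b : ℝ) ≤ a := by exact_mod_cast hab
  have hj' : (j : ℝ) < b := by exact_mod_cast hj
  refine Finset.prod_le_prod (fun i _ => (Real.exp_pos _).le) fun i hi => ?_
  have hi' : (i : ℝ) ≤ j := by exact_mod_cast (Finset.mem_range.1 hi).le
  have hi0 : (0 : ℝ) ≤ i := i.cast_nonneg
  have hpos : (0 : ℝ) < 2 * (b - i) := by linarith
  have hpos' : (0 : ℝ) < a + b - i := by linarith
  rw [Real.exp_neg, ← inv_div (_ - _)]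
  refine inv_anti₀ (div_pos hpos' hpos) ?_
  calc ((a : ℝ) + b - i) / (2 * (b - i)) = (a - b + i) / (2 * (b - i)) + 1 := by
        rw [div_add_one hpos.ne']
        ring
    _ ≤ (a - b + i) / (2 * (b - j)) + 1 := by
        gcongr
    _ ≤ _ := Real.add_one_le_exp _

lemma tendsto_floor_mul_sub_one_div {z : ℝ} (hz : 0 ≤ z) :
    Tendsto (fun x : ℝ => ((⌊z * x⌋₊ - 1 : ℕ) : ℝ) / x) atTop (nhds z) := by
  have h := tendsto_nat_floor_mul_div_atTop hz
  have h' : Tendsto (fun x : ℝ => (⌊z * x⌋₊ : ℝ) / x - x⁻¹) atTop (nhds z) := by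
    simpa using h.sub tendsto_inv_atTop_zero
  refine tendsto_of_tendsto_of_tendsto_of_le_of_le' h' h ?_ ?_ <;>
    filter_upwards [eventually_gt_atTop 0] with x hx
  · rw [inv_eq_one_div, ← sub_div]
    gcongr
    have : ⌊z * x⌋₊ ≤ (⌊z * x⌋₊ - 1) + 1 := by omega
    have : (⌊z * x⌋₊ : ℝ) ≤ ((⌊z * x⌋₊ - 1 : ℕ) : ℝ) + 1 := by exact_mod_cast this
    linarith
  · gcongr
    omega

theorem stmt11 (t : ℝ) (ht : 0 < t) (m1 m2 : ℕ → ℕ)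
    (hm1 : Tendsto m1 atTop atTop)
    (hdiff : Tendsto (fun ν => ((m1 ν : ℝ) - (m2 ν : ℝ)) / Real.sqrt (m1 ν)) atTop (nhds t))
    (z : ℝ) (hz : 0 ≤ z) :
    Tendsto (fun ν : ℕ =>
        (∑' k : ℕ,
            if (k : ℝ) ≤ z * Real.sqrt (m1 ν) then (gP (m1 ν) (m2 ν)).coeff k else 0)
          / ((m1 ν + m2 ν).choose (m1 ν) : ℝ))
      atTop (nhds (1 - Real.exp (-(z * (2 * t + z)) / 4))) := by
  set s : ℕ → ℝ := fun ν => Real.sqrt (m1 ν) with hs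
  set j : ℕ → ℕ := fun ν => ⌊z * s ν⌋₊ - 1 with hj
  have hs_top : Tendsto s atTop atTop :=
    Real.tendsto_sqrt_atTop.comp (tendsto_natCast_atTop_atTop.comp hm1)
  have hs_inv : Tendsto (fun ν => (s ν)⁻¹) atTop (nhds 0) := tendsto_inv_atTop_zero.comp hs_top
  have hs_pos : ∀ᶠ ν in atTop, 0 < s ν := hs_top.eventually_gt_atTop 0
  have hs_sq : ∀ ν, (m1 ν : ℝ) = s ν ^ 2 := fun ν => (Real.sq_sqrt (Nat.cast_nonneg _)).symm
  have hj_lim : Tendsto (fun ν => (j ν : ℝ) / s ν) atTop (nhds z) :=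
    (tendsto_floor_mul_sub_one_div hz).comp hs_top
  have hgap : ∀ᶠ ν in atTop, m2 ν + 2 ≤ m1 ν := by
    have h : Tendsto (fun ν => ((m1 ν : ℝ) - m2 ν) / s ν * s ν) atTop atTop :=
      hdiff.pos_mul_atTop ht hs_top
    filter_upwards [h.eventually_ge_atTop 2, hs_pos] with ν h2 hν
    rw [div_mul_cancel₀ _ hν.ne'] at h2
    have : (m2 ν : ℝ) + 2 ≤ m1 ν := by linarith
    exact_mod_cast this
  have hnum : Tendsto
      (fun ν => (j ν * ((m1 ν : ℝ) - m2 ν) + j ν * (j ν - 1) / 2) / s ν ^ 2) atTop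
      (nhds (z * t + z * (z - 0) / 2)) := by
    refine ((hj_lim.mul hdiff).add
      ((hj_lim.mul (hj_lim.sub hs_inv)).div_const 2)).congr' ?_
    filter_upwards [hs_pos] with ν hν
    change (j ν : ℝ) / s ν * (((m1 ν : ℝ) - m2 ν) / s ν)
      + (j ν : ℝ) / s ν * ((j ν : ℝ) / s ν - (s ν)⁻¹) / 2 = _
    field_simp
  have hsum : Tendsto (fun ν => ((m1 ν : ℝ) + m2 ν) / s ν ^ 2) atTop (nhds (2 - t * 0)) := by
    refine (tendsto_const_nhds.sub (hdiff.mul hs_inv)).congr' ?_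
    filter_upwards [hs_pos] with ν hν
    change 2 - ((m1 ν : ℝ) - m2 ν) / s ν * (s ν)⁻¹ = _
    rw [hs_sq]
    field_simp
    ring
  have hden : Tendsto (fun ν => (2 * ((m2 ν : ℝ) - j ν)) / s ν ^ 2) atTop
      (nhds (2 * (1 - t * 0 - z * 0))) := by
    refine (((tendsto_const_nhds.sub (hdiff.mul hs_inv)).sub
      (hj_lim.mul hs_inv)).const_mul 2).congr' ?_
    filter_upwards [hs_pos] with ν hν
    change 2 * (1 - ((m1 ν : ℝ) - m2 ν) / s ν * (s ν)⁻¹ - (j ν : ℝ) / s ν * (s ν)⁻¹) = _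
    rw [hs_sq]
    field_simp
    ring
  have hj_lt : ∀ᶠ ν in atTop, j ν < m2 ν := by
    have h_pos : (0 : ℝ) < 2 * (1 - t * 0 - z * 0) := by norm_num
    filter_upwards [hden.eventually_const_lt h_pos, hs_pos] with ν h hν
    rw [div_pos_iff_of_pos_right (by positivity)] at h
    have : (j ν : ℝ) < m2 ν := by linarith
    exact_mod_cast this
  have hexp : ∀ {D : ℕ → ℝ} {l : ℝ}, l = 2 → Tendsto (fun ν => D ν / s ν ^ 2) atTop (nhds l) →
      Tendsto (fun ν => Real.exp (-((j ν * ((m1 ν : ℝ) - m2 ν) + j ν * (j ν - 1) / 2) / D ν)))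
        atTop (nhds (Real.exp (-(z * (2 * t + z)) / 4))) := by
    rintro D l rfl hD
    have h := (hnum.div hD two_ne_zero).neg.rexp
    rw [show -((z * t + z * (z - 0) / 2) / 2) = -(z * (2 * t + z)) / 4 by ring] at h
    refine h.congr' ?_
    filter_upwards [hs_pos] with ν hν
    simp only [Pi.div_apply]
    rw [div_div_div_cancel_right₀ (by positivity)]
  have hprod : Tendsto (fun ν => ∏ i ∈ Finset.range (j ν),
      (2 * ((m2 ν : ℝ) - i) / ((m1 ν : ℝ) + m2 ν - i))) atTop
      (nhds (Real.exp (-(z * (2 * t + z)) / 4))) := by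
    refine tendsto_of_tendsto_of_tendsto_of_le_of_le' (hexp (by ring) hden) (hexp (by ring) hsum)
      ?_ ?_ <;> filter_upwards [hgap, hj_lt] with ν h1 h2
    · exact exp_le_prod_ratio (by omega) h2
    · exact prod_ratio_le_exp (by omega) h2.le
  refine (hprod.const_sub 1).congr' ?_
  filter_upwards [hgap, hj_lt] with ν h1 h2
  have hC : ((m1 ν + m2 ν).choose (m1 ν) : ℝ) ≠ 0 :=
    Nat.cast_ne_zero.2 (Nat.choose_pos (Nat.le_add_right _ _)).ne'
  rw [tsum_ite_le_coeff _ (mul_nonneg hz (Real.sqrt_nonneg _)), partialCoeffSum_gP,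
    gPTail_succ_of_add_two_le h1, two_pow_mul_choose_sub_eq_prod _ _ (j ν) h2.le, sub_div,
    div_self hC, mul_div_cancel_left₀ _ hC]
end

section
/- For all integers m1, m2 ≥ 0, the polynomial g_{m1,m2}(q) equals Σ_p q^{w(p)}, where the sum runs over all lattice paths p of length m1 + m2 with steps in {+1, −1} that end at altitude m2 − m1. -/
/-- The value of a lattice-path step: `+1` for an up-step (`true`), `-1` for a down-step. -/
def stepVal (b : Bool) : ℤ := if b then 1 else -1

/-- The altitude of the lattice path `p` after its step with index `i` (i.e. after `i+1` steps),
starting from altitude `0`. -/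
def altAfter {n : ℕ} (p : Fin n → Bool) (i : Fin n) : ℤ :=
  ∑ j ∈ Finset.univ.filter (fun j : Fin n => (j : ℕ) ≤ (i : ℕ)), stepVal (p j)

/-- The weight `w(p)` of a lattice path: the number of down-steps after which the altitude
lies in `{-1, -2}`. -/
def pathWeight {n : ℕ} (p : Fin n → Bool) : ℕ :=
  (Finset.univ.filter (fun i : Fin n =>
    p i = false ∧ (altAfter p i = -1 ∨ altAfter p i = -2))).card

open Polynomial in
/-- The generating polynomial, by weight, of the lattice paths of length `n` ending at `k`. -/
noncomputable def pathPoly (n : ℕ) (k : ℤ) : ℝ[X] :=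
  ∑ p : Fin n → Bool with ∑ j, stepVal (p j) = k, X ^ pathWeight p

theorem altAfter_snoc_castSucc {n : ℕ} (p : Fin n → Bool) (b : Bool) (i : Fin n) :
    altAfter (Fin.snoc p b : Fin (n + 1) → Bool) i.castSucc = altAfter p i := by
  have h : ¬ n ≤ (i : ℕ) := by omega
  simp [altAfter, Finset.sum_filter, Fin.sum_univ_castSucc, h]

theorem altAfter_last {n : ℕ} (p : Fin (n + 1) → Bool) :
    altAfter p (Fin.last n) = ∑ j, stepVal (p j) := by
  simp [altAfter, Finset.filter_true_of_mem, Fin.is_le]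

theorem sum_stepVal_snoc {n : ℕ} (p : Fin n → Bool) (b : Bool) :
    ∑ j, stepVal ((Fin.snoc p b : Fin (n + 1) → Bool) j) = ∑ j, stepVal (p j) + stepVal b := by
  simp [Fin.sum_univ_castSucc]

theorem pathWeight_snoc {n : ℕ} (p : Fin n → Bool) (b : Bool) :
    pathWeight (Fin.snoc p b : Fin (n + 1) → Bool) = pathWeight p +
      if b = false ∧ (∑ j, stepVal (p j) + stepVal b = -1 ∨ ∑ j, stepVal (p j) + stepVal b = -2)
        then 1 else 0 := by
  simp only [pathWeight, Finset.card_filter, Fin.sum_univ_castSucc (n := n), Fin.snoc_castSucc,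
    Fin.snoc_last, altAfter_snoc_castSucc, altAfter_last]

open Polynomial in
theorem pathPoly_succ (n : ℕ) (k : ℤ) :
    pathPoly (n + 1) k =
      X ^ (if k = -1 ∨ k = -2 then 1 else 0) * pathPoly n (k + 1) + pathPoly n (k - 1) := by
  simp only [pathPoly, Finset.sum_filter]
  rw [← (Fin.snocEquiv fun _ => Bool).sum_comp, Fintype.sum_prod_type, Fintype.sum_bool, add_comm]
  have weight_snoc (b : Bool) (p : Fin n → Bool) :
      pathWeight ((Fin.snocEquiv fun _ => Bool) (b, p)) = _ := pathWeight_snoc p b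
  have hf : stepVal false = -1 := rfl
  have ht : stepVal true = 1 := rfl
  simp only [Fin.snocEquiv_apply, sum_stepVal_snoc, weight_snoc, Finset.mul_sum]
  congr 1
  · refine Finset.sum_congr rfl fun p _ => ?_
    by_cases h : ∑ j, stepVal (p j) = k + 1
    · simp [h, hf, pow_add, mul_comm]
    · have h' : ¬ ∑ j, stepVal (p j) + -1 = k := by omega
      simp only [hf, h, h', if_false, mul_zero]
  · refine Finset.sum_congr rfl fun p _ => ?_
    simp [ht, eq_sub_iff_add_eq]

theorem abs_sum_stepVal_le {n : ℕ} (p : Fin n → Bool) : |∑ j, stepVal (p j)| ≤ n := by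
  refine (Finset.abs_sum_le_sum_abs _ _).trans ?_
  have h (b : Bool) : |stepVal b| = 1 := by cases b <;> simp [stepVal]
  simp [h]

theorem pathPoly_eq_zero {n : ℕ} {k : ℤ} (h : (n : ℤ) < |k|) : pathPoly n k = 0 := by
  rw [pathPoly, Finset.filter_false_of_mem, Finset.sum_empty]
  rintro p - rfl
  exact absurd (abs_sum_stepVal_le p) (not_le.mpr h)

theorem gP_eq_pathPoly (m1 m2 : ℕ) : gP m1 m2 = pathPoly (m1 + m2) ((m2 : ℤ) - m1) := by
  induction m1, m2 using gP.induct with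
  | case1 => simp [gP, pathPoly, pathWeight]
  | case2 m2 ih =>
    have h : pathPoly m2 (((m2 + 1 : ℕ) : ℤ) - (0 : ℕ) + 1) = 0 :=
      pathPoly_eq_zero (by rw [lt_abs]; omega)
    rw [gP, ih, Nat.succ_eq_add_one, zero_add, zero_add, pathPoly_succ, h, mul_zero, zero_add]
    congr 1
    omega
  | case3 m1 ih =>
    have h : pathPoly m1 (((0 : ℕ) : ℤ) - (m1 + 1 : ℕ) - 1) = 0 :=
      pathPoly_eq_zero (by rw [lt_abs]; omega)
    rw [gP, ih, Nat.succ_eq_add_one, add_zero, add_zero, pathPoly_succ, h, add_zero]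
    congr 3
    · grind
    · omega
  | case4 m1 m2 ih1 ih2 =>
    rw [gP, ih1, ih2, ← add_assoc (m1 + 1) m2 1, pathPoly_succ]
    congr 2
    · congr 1
      grind
    · congr 1 <;> omega
    · omega

theorem stmt12 (m1 m2 : ℕ) :
    gP m1 m2 =
      ∑ p ∈ Finset.univ.filter
          (fun p : Fin (m1 + m2) → Bool => ∑ j, stepVal (p j) = (m2 : ℤ) - (m1 : ℤ)),
        (Polynomial.X : Polynomial ℝ) ^ pathWeight p :=
  gP_eq_pathPoly m1 m2
end

section
/- Let δ ≥ 2 be an integer, z ∈ (0,1/2) and q ∈ (0,1]. Then Σ_p z^{length(p)}·q^{w(p)}, where the sum runs over all lattice paths p with steps in {+1,−1} ending at altitude −δ, converges and equals q²·(z·E(z))^{δ} / (1 − 2·z²·q·E(z)). -/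
/-- `E(z) = (1 - √(1-4z²))/(2z²)`, the generating function of Dyck excursions. -/
noncomputable def Egf (z : ℝ) : ℝ := (1 - Real.sqrt (1 - 4 * z ^ 2)) / (2 * z ^ 2)

/-- The total weight of the lattice paths of length `n` ending at altitude `k`. -/
noncomputable def pathSum (q : ℝ) (n : ℕ) (k : ℤ) : ℝ :=
  ∑ p ∈ Finset.univ.filter (fun p : Fin n → Bool => ∑ j, stepVal (p j) = k), q ^ pathWeight p

theorem altAfter_snoc_last {n : ℕ} (p : Fin n → Bool) (b : Bool) :
    altAfter (Fin.snoc p b : Fin (n + 1) → Bool) (Fin.last n) =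
      ∑ j, stepVal (p j) + stepVal b := by
  simp [altAfter, Finset.sum_filter, Fin.sum_univ_castSucc, Fin.is_le']

theorem pathSum_zero (q : ℝ) (k : ℤ) : pathSum q 0 k = if k = 0 then 1 else 0 := by
  by_cases hk : k = 0 <;> simp [pathSum, pathWeight, @eq_comm ℤ 0 k, hk]

theorem pathSum_succ (q : ℝ) (n : ℕ) (k : ℤ) :
    pathSum q (n + 1) k = pathSum q n (k - 1) +
      (if k = -1 ∨ k = -2 then q else 1) * pathSum q n (k + 1) := by
  simp only [pathSum, Finset.sum_filter]
  rw [← (Fin.snocEquiv (fun _ : Fin (n + 1) => Bool)).sum_comp, Fintype.sum_prod_type,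
    Fintype.sum_bool, Finset.mul_sum]
  congr 1 <;> refine Finset.sum_congr rfl fun p _ => ?_
  · simp [Fin.snocEquiv, pathWeight_snoc, Fin.sum_univ_castSucc, stepVal, eq_sub_iff_add_eq]
  · simp only [Fin.snocEquiv, Equiv.coe_fn_mk, pathWeight_snoc, Fin.sum_univ_castSucc,
      Fin.snoc_castSucc, Fin.snoc_last]
    generalize ∑ j, stepVal (p j) = s
    have h : stepVal false = -1 := rfl
    rw [h]
    by_cases hs : s = k + 1
    · subst hs
      by_cases hk : k = -1 ∨ k = -2 <;> simp [hk, pow_succ, mul_comm]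
    · have : ¬ s + -1 = k := by lia
      simp [hs, this]

theorem pathSum_nonneg {q : ℝ} (hq : 0 ≤ q) (n : ℕ) (k : ℤ) : 0 ≤ pathSum q n k :=
  Finset.sum_nonneg fun _ _ => pow_nonneg hq _

theorem pathSum_le_two_pow {q : ℝ} (hq : 0 ≤ q) (hq1 : q ≤ 1) (n : ℕ) (k : ℤ) :
    pathSum q n k ≤ 2 ^ n := by
  calc pathSum q n k ≤ ∑ p : Fin n → Bool, (1 : ℝ) :=
        (Finset.sum_le_sum fun _ _ => pow_le_one₀ hq hq1).trans
          (Finset.sum_le_sum_of_subset_of_nonneg (Finset.filter_subset _ _) (by simp))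
    _ = 2 ^ n := by simp

theorem pow_mul_pathSum_le {z q : ℝ} (hz : 0 ≤ z) (hq : 0 ≤ q) (hq1 : q ≤ 1) (n : ℕ) (k : ℤ) :
    z ^ n * pathSum q n k ≤ (2 * z) ^ n := by
  rw [mul_pow, mul_comm]
  exact mul_le_mul_of_nonneg_right (pathSum_le_two_pow hq hq1 n k) (pow_nonneg hz n)

theorem summable_pow_mul_pathSum {z q : ℝ} (hz : 0 ≤ z) (hz2 : 2 * z < 1) (hq : 0 ≤ q)
    (hq1 : q ≤ 1) (k : ℤ) : Summable fun n : ℕ => z ^ n * pathSum q n k :=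
  .of_nonneg_of_le (fun n => mul_nonneg (pow_nonneg hz n) (pathSum_nonneg hq n k))
    (fun n => pow_mul_pathSum_le hz hq hq1 n k)
    (summable_geometric_of_lt_one (by positivity) hz2)

theorem tsum_pow_mul_pathSum_eq {z q : ℝ} (hz : 0 ≤ z) (hz2 : 2 * z < 1) (hq : 0 ≤ q)
    (hq1 : q ≤ 1) (k : ℤ) :
    ∑' n : ℕ, z ^ n * pathSum q n k = (if k = 0 then 1 else 0) +
      z * ∑' n : ℕ, z ^ n * pathSum q n (k - 1) +
      z * (if k = -1 ∨ k = -2 then q else 1) * ∑' n : ℕ, z ^ n * pathSum q n (k + 1) := by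
  have hs := summable_pow_mul_pathSum hz hz2 hq hq1
  rw [(hs k).tsum_eq_zero_add, ← tsum_mul_left, ← tsum_mul_left, add_assoc,
    ← ((hs (k - 1)).mul_left _).tsum_add ((hs (k + 1)).mul_left _)]
  congr 1
  · simp [pathSum_zero]
  · refine tsum_congr fun n => ?_
    rw [pathSum_succ]
    ring

/-- A bounded solution of a homogeneous nearest-neighbour recurrence vanishes when its
coefficients contract the supremum norm. -/
theorem eq_zero_of_bounded_of_recurrence {z M : ℝ} (hz : 0 ≤ z) (hz2 : 2 * z < 1)
    {c D : ℤ → ℝ} (hc : ∀ k, |c k| ≤ 1) (hM : ∀ k, |D k| ≤ M)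
    (hD : ∀ k, D k = z * D (k - 1) + z * c k * D (k + 1)) (k : ℤ) : D k = 0 := by
  have key : ∀ n : ℕ, ∀ k, |D k| ≤ (2 * z) ^ n * M := by
    intro n
    induction n with
    | zero => simpa using hM
    | succ n ih =>
      intro k
      rw [hD k]
      calc |z * D (k - 1) + z * c k * D (k + 1)|
          ≤ z * |D (k - 1)| + z * |c k| * |D (k + 1)| := by
            refine (abs_add_le _ _).trans (le_of_eq ?_)
            simp only [abs_mul, abs_of_nonneg hz]
        _ ≤ z * ((2 * z) ^ n * M) + z * 1 * ((2 * z) ^ n * M) := by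
            gcongr
            exacts [ih _, hc k, ih _]
        _ = (2 * z) ^ (n + 1) * M := by ring
  have ht : Filter.Tendsto (fun n : ℕ => (2 * z) ^ n * M) Filter.atTop (nhds 0) := by
    simpa using (tendsto_pow_atTop_nhds_zero_of_lt_one (by positivity) hz2).mul_const M
  exact abs_nonpos_iff.mp (ge_of_tendsto' ht fun n => key n k)

/-- The generating function of the lattice paths by final altitude, in terms of `u = z E(z)`. -/
noncomputable def altitudeGF (z q u : ℝ) : ℤ → ℝ
  | Int.ofNat n => (u / z + u * (q * u / (1 - 2 * z * u * q))) * u ^ n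
  | Int.negSucc 0 => q * u / (1 - 2 * z * u * q)
  | Int.negSucc (n + 1) => q ^ 2 * u ^ (n + 2) / (1 - 2 * z * u * q)

theorem altitudeGF_bounded {z q u : ℝ} (hu : 0 ≤ u) (hu1 : u ≤ 1) :
    ∃ M, ∀ k, |altitudeGF z q u k| ≤ M := by
  refine ⟨|u / z + u * (q * u / (1 - 2 * z * u * q))| + |q * u / (1 - 2 * z * u * q)| +
    |q ^ 2 / (1 - 2 * z * u * q)|, fun k => ?_⟩
  have hp (n : ℕ) : |u ^ n| ≤ 1 := by
    rw [abs_of_nonneg (pow_nonneg hu n)]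
    exact pow_le_one₀ hu hu1
  have hmul (a : ℝ) (n : ℕ) : |a * u ^ n| ≤ |a| := by
    rw [abs_mul]
    exact mul_le_of_le_one_right (abs_nonneg a) (hp n)
  match k with
  | Int.ofNat n =>
    refine (hmul _ n).trans ?_
    linarith [abs_nonneg (q * u / (1 - 2 * z * u * q)),
      abs_nonneg (q ^ 2 / (1 - 2 * z * u * q))]
  | Int.negSucc 0 =>
    simp only [altitudeGF]
    linarith [abs_nonneg (u / z + u * (q * u / (1 - 2 * z * u * q))),
      abs_nonneg (q ^ 2 / (1 - 2 * z * u * q))]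
  | Int.negSucc (n + 1) =>
    simp only [altitudeGF, mul_div_right_comm]
    refine (hmul _ _).trans ?_
    simp only [← mul_div_right_comm]
    linarith [abs_nonneg (u / z + u * (q * u / (1 - 2 * z * u * q))),
      abs_nonneg (q * u / (1 - 2 * z * u * q))]

theorem altitudeGF_eq {z q u : ℝ} (hz : z ≠ 0) (hu : u = z * (1 + u ^ 2))
    (hden : 1 - 2 * z * u * q ≠ 0) (k : ℤ) :
    altitudeGF z q u k = (if k = 0 then 1 else 0) + z * altitudeGF z q u (k - 1) +
      z * (if k = -1 ∨ k = -2 then q else 1) * altitudeGF z q u (k + 1) := by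
  match k with
  | Int.ofNat 0 =>
    change (u / z + u * (q * u / (1 - 2 * z * u * q))) * u ^ 0 =
      1 + z * (q * u / (1 - 2 * z * u * q)) +
        z * 1 * ((u / z + u * (q * u / (1 - 2 * z * u * q))) * u ^ 1)
    have hv : u / z = 1 + u ^ 2 := by
      rw [div_eq_iff hz]
      linarith
    rw [hv]
    linear_combination (q * u / (1 - 2 * z * u * q) + u) * hu
  | Int.ofNat (n + 1) =>
    have h0 : Int.ofNat (n + 1) ≠ 0 := by simp; lia
    have h1 : ¬ (Int.ofNat (n + 1) = -1 ∨ Int.ofNat (n + 1) = -2) := by simp; lia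
    have h2 : Int.ofNat (n + 1) - 1 = Int.ofNat n := by simp
    have h3 : Int.ofNat (n + 1) + 1 = Int.ofNat (n + 2) := rfl
    rw [if_neg h0, if_neg h1, h2, h3]
    simp only [altitudeGF]
    generalize u / z + u * (q * u / (1 - 2 * z * u * q)) = a
    linear_combination a * u ^ n * hu
  | Int.negSucc 0 =>
    change q * u / (1 - 2 * z * u * q) = 0 + z * (q ^ 2 * u ^ 2 / (1 - 2 * z * u * q)) +
      z * q * ((u / z + u * (q * u / (1 - 2 * z * u * q))) * u ^ 0)
    have hC : q * u / (1 - 2 * z * u * q) * (1 - 2 * z * u * q) = q * u := div_mul_cancel₀ _ hden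
    have hv : z * (u / z) = u := mul_div_cancel₀ _ hz
    linear_combination hC - q * hv
  | Int.negSucc 1 =>
    change q ^ 2 * u ^ 2 / (1 - 2 * z * u * q) =
      0 + z * (q ^ 2 * u ^ 3 / (1 - 2 * z * u * q)) + z * q * (q * u / (1 - 2 * z * u * q))
    linear_combination q ^ 2 * u / (1 - 2 * z * u * q) * hu
  | Int.negSucc (n + 2) =>
    change q ^ 2 * u ^ (n + 3) / (1 - 2 * z * u * q) =
      0 + z * (q ^ 2 * u ^ (n + 4) / (1 - 2 * z * u * q)) +
        z * (if Int.negSucc (n + 2) = -1 ∨ Int.negSucc (n + 2) = -2 then q else 1) *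
          (q ^ 2 * u ^ (n + 2) / (1 - 2 * z * u * q))
    rw [if_neg (by lia)]
    linear_combination q ^ 2 * u ^ (n + 2) / (1 - 2 * z * u * q) * hu

theorem mul_Egf_eq {z : ℝ} (hz : 0 < z) (hz2 : 2 * z < 1) :
    z * Egf z = z * (1 + (z * Egf z) ^ 2) := by
  have hs := Real.sq_sqrt (show 0 ≤ 1 - 4 * z ^ 2 by nlinarith)
  simp only [Egf]
  generalize √(1 - 4 * z ^ 2) = r at *
  field_simp
  linear_combination -hs

theorem mul_Egf_mem_Ioo {z : ℝ} (hz : 0 < z) (hz2 : 2 * z < 1) :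
    z * Egf z ∈ Set.Ioo (0 : ℝ) 1 := by
  have h0 : 0 ≤ 1 - 4 * z ^ 2 := by nlinarith
  have h : z * Egf z = (1 - √(1 - 4 * z ^ 2)) / (2 * z) := by
    simp only [Egf]
    field_simp
  rw [h]
  constructor
  · have : √(1 - 4 * z ^ 2) < 1 := by
      rw [Real.sqrt_lt' one_pos]
      nlinarith
    exact div_pos (by linarith) (by linarith)
  · have : 1 - 2 * z < √(1 - 4 * z ^ 2) := by
      apply Real.lt_sqrt_of_sq_lt
      nlinarith
    rw [div_lt_one (by linarith)]
    linarith

theorem tsum_pow_mul_pathSum {z q : ℝ} (hz : 0 < z) (hz2 : 2 * z < 1) (hq : 0 ≤ q)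
    (hq1 : q ≤ 1) (k : ℤ) :
    ∑' n : ℕ, z ^ n * pathSum q n k = altitudeGF z q (z * Egf z) k := by
  obtain ⟨hu0, hu1⟩ := mul_Egf_mem_Ioo hz hz2
  have hu := mul_Egf_eq hz hz2
  generalize z * Egf z = u at *
  have hden : 1 - 2 * z * u * q ≠ 0 := by
    have : 2 * z * u * q < 1 := by
      calc 2 * z * u * q ≤ 2 * z * u := mul_le_of_le_one_right (by positivity) hq1
        _ ≤ 2 * z := mul_le_of_le_one_right (by positivity) hu1.le
        _ < 1 := hz2
    linarith
  obtain ⟨M, hM⟩ := altitudeGF_bounded (z := z) (q := q) hu0.le hu1.le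
  have hF (k : ℤ) : |∑' n : ℕ, z ^ n * pathSum q n k| ≤ (1 - 2 * z)⁻¹ := by
    rw [abs_of_nonneg
      (tsum_nonneg fun n => mul_nonneg (pow_nonneg hz.le n) (pathSum_nonneg hq n k)),
      ← tsum_geometric_of_lt_one (by positivity) hz2]
    exact (summable_pow_mul_pathSum hz.le hz2 hq hq1 k).tsum_le_tsum
      (fun n => pow_mul_pathSum_le hz.le hq hq1 n k)
      (summable_geometric_of_lt_one (by positivity) hz2)
  refine sub_eq_zero.mp (eq_zero_of_bounded_of_recurrence hz.le hz2
    (c := fun k => if k = -1 ∨ k = -2 then q else 1)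
    (D := fun k => ∑' n : ℕ, z ^ n * pathSum q n k - altitudeGF z q u k)
    (fun k => ?_) (fun k => (abs_sub _ _).trans (add_le_add (hF k) (hM k))) (fun k => ?_) k)
  · split_ifs
    · rwa [abs_of_nonneg hq]
    · simp
  · linear_combination tsum_pow_mul_pathSum_eq hz.le hz2 hq hq1 k - altitudeGF_eq hz.ne' hu hden k

theorem stmt13 (d : ℕ) (hd : 2 ≤ d) (z q : ℝ) (hz : z ∈ Set.Ioo (0 : ℝ) (1 / 2))
    (hq : q ∈ Set.Ioc (0 : ℝ) 1) :
    Summable (fun n : ℕ =>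
      ∑ p ∈ Finset.univ.filter (fun p : Fin n → Bool => ∑ j, stepVal (p j) = -(d : ℤ)),
        z ^ n * q ^ pathWeight p) ∧
    ∑' n : ℕ,
        ∑ p ∈ Finset.univ.filter (fun p : Fin n → Bool => ∑ j, stepVal (p j) = -(d : ℤ)),
          z ^ n * q ^ pathWeight p
      = q ^ 2 * (z * Egf z) ^ d / (1 - 2 * z ^ 2 * q * Egf z) := by
  obtain ⟨hz0, hz2⟩ := hz
  obtain ⟨hq0, hq1⟩ := hq
  replace hz2 : 2 * z < 1 := by linarith
  simp only [← Finset.mul_sum]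
  refine ⟨summable_pow_mul_pathSum hz0.le hz2 hq0.le hq1 _,
    (tsum_pow_mul_pathSum hz0 hz2 hq0.le hq1 _).trans ?_⟩
  obtain ⟨m, rfl⟩ := Nat.exists_eq_add_of_le' hd
  change q ^ 2 * (z * Egf z) ^ (m + 2) / (1 - 2 * z * (z * Egf z) * q) = _
  congr 1
  ring
end

section
/- For every integer s ≥ 1, μ̃_s ≤ (2s)!, so the moment sequence (μ̃_s) satisfies Carleman's criterion Σ_{s≥1} μ̃_s^{−1/(2s)} = +∞ and hence determines a unique probability distribution on [0,∞). -/
open MeasureTheory Filter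

/-- The integer and half-integer values of the Gamma function are bounded by factorials. -/
lemma Real.Gamma_nat_add_one_div_two_le (k : ℕ) :
    Real.Gamma (((k : ℝ) + 1) / 2) ≤ √Real.pi * (k.factorial : ℝ) := by
  induction k using Nat.twoStepInduction with
  | zero => simp [← Real.Gamma_one_half_eq]
  | one =>
    have : (1 : ℝ) ≤ √Real.pi := Real.one_le_sqrt.2 (by linarith [Real.pi_gt_three])
    simpa using this
  | more k ih _ =>
    have e : (((k + 2 : ℕ) : ℝ) + 1) / 2 = ((k : ℝ) + 1) / 2 + 1 := by push_cast; ring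
    rw [e, Real.Gamma_add_one (by positivity), Nat.factorial_succ, Nat.factorial_succ]
    push_cast
    have h : ((k : ℝ) + 1) / 2 ≤ ((k : ℝ) + 1 + 1) * ((k : ℝ) + 1) := by
      nlinarith [k.cast_nonneg (α := ℝ)]
    calc ((k : ℝ) + 1) / 2 * Real.Gamma (((k : ℝ) + 1) / 2)
        ≤ (((k : ℝ) + 1 + 1) * ((k : ℝ) + 1)) * (√Real.pi * (k.factorial : ℝ)) := by
          gcongr
      _ = _ := by ring

lemma mutilde_pos (s : ℕ) : 0 < mutilde s := by
  refine Finset.sum_pos (fun k hk ↦ ?_) ⟨0, by simp⟩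
  have hks : k ≤ s := Nat.lt_succ_iff.mp (Finset.mem_range.mp hk)
  have h : (0 : ℝ) < (s : ℝ) - k + 1 := by
    have : (k : ℝ) ≤ s := by exact_mod_cast hks
    linarith
  have := Nat.choose_pos hks
  have := Real.Gamma_pos_of_pos (half_pos h)
  have := Real.Gamma_pos_of_pos (show (0 : ℝ) < ((k : ℝ) + 1) / 2 by positivity)
  positivity

lemma mutilde_le_factorial_succ (s : ℕ) : mutilde s ≤ ((s + 1).factorial : ℝ) := by
  have hterm : ∀ k ∈ Finset.range (s + 1),
      (s.choose k : ℝ) * Real.Gamma (((k : ℝ) + 1) / 2) *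
        Real.Gamma (((s : ℝ) - (k : ℝ) + 1) / 2) / Real.pi ≤ (s.factorial : ℝ) := by
    intro k hk
    have hks : k ≤ s := Nat.lt_succ_iff.mp (Finset.mem_range.mp hk)
    rw [← Nat.cast_sub hks, div_le_iff₀ Real.pi_pos, ← Nat.choose_mul_factorial_mul_factorial hks]
    push_cast
    calc (s.choose k : ℝ) * Real.Gamma (((k : ℝ) + 1) / 2) *
          Real.Gamma ((((s - k : ℕ) : ℝ) + 1) / 2)
        ≤ (s.choose k : ℝ) * (√Real.pi * (k.factorial : ℝ)) *
          (√Real.pi * ((s - k).factorial : ℝ)) := by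
          gcongr
          · exact Real.Gamma_nat_add_one_div_two_le k
          · exact Real.Gamma_nat_add_one_div_two_le (s - k)
      _ = (s.choose k : ℝ) * k.factorial * (s - k).factorial * (√Real.pi * √Real.pi) := by ring
      _ = _ := by rw [Real.mul_self_sqrt Real.pi_pos.le]
  calc mutilde s ≤ ∑ _k ∈ Finset.range (s + 1), (s.factorial : ℝ) := Finset.sum_le_sum hterm
    _ = _ := by simp [Nat.factorial_succ]

lemma mutilde_le_factorial_two_mul {s : ℕ} (hs : 1 ≤ s) :
    mutilde s ≤ ((2 * s).factorial : ℝ) :=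
  (mutilde_le_factorial_succ s).trans (by exact_mod_cast Nat.factorial_le (by lia))

/-- Carleman's criterion holds for a positive sequence bounded by `(2s)!`. -/
lemma tendsto_sum_rpow_of_le_factorial {m : ℕ → ℝ} (hpos : ∀ s, 1 ≤ s → 0 < m s)
    (hle : ∀ s, 1 ≤ s → m s ≤ ((2 * s).factorial : ℝ)) :
    Tendsto (fun N : ℕ ↦ ∑ s ∈ Finset.Icc 1 N, m s ^ (-(1 / (2 * (s : ℝ)))))
      atTop atTop := by
  refine tendsto_atTop_mono
    (f := fun N : ℕ ↦ (1 / 2 : ℝ) * ∑ i ∈ Finset.range N, 1 / ((i : ℝ) + 1))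
    (fun N ↦ ?_) (Real.tendsto_sum_range_one_div_nat_succ_atTop.const_mul_atTop (by norm_num))
  rw [← Finset.Ico_add_one_right_eq_Icc, Finset.sum_Ico_eq_sum_range, Finset.mul_sum]
  refine Finset.sum_le_sum fun i _ ↦ ?_
  have hs : 1 ≤ 1 + i := by lia
  generalize hsi : 1 + i = s at hs
  have hs0 : (0 : ℝ) < 2 * s := by
    have : (0 : ℝ) < s := by exact_mod_cast hs
    positivity
  have hpow : m s ≤ (2 * (s : ℝ)) ^ (2 * (s : ℝ)) := by
    refine (hle s hs).trans ?_
    have : (2 * (s : ℝ)) ^ (2 * (s : ℝ)) = ((2 * s) ^ (2 * s) : ℕ) := by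
      push_cast
      rw [← Real.rpow_natCast]
      push_cast
      rfl
    rw [this]
    exact_mod_cast Nat.factorial_le_pow _
  calc (1 / 2 : ℝ) * (1 / ((i : ℝ) + 1))
      = ((2 * (s : ℝ)) ^ (2 * (s : ℝ))) ^ (-(1 / (2 * (s : ℝ)))) := by
        rw [← Real.rpow_mul hs0.le, show 2 * (s : ℝ) * -(1 / (2 * (s : ℝ))) = -1 by field_simp,
          Real.rpow_neg_one, ← hsi]
        push_cast
        field_simp
        ring
    _ ≤ _ := Real.rpow_le_rpow_of_nonpos (hpos s hs) hpow (by
        rw [neg_nonpos]; positivity)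

/-- A measure on `[0, ∞)` whose moments are dominated by the coefficients of an exponential series
convergent at `t` integrates `exp (t * x)`. -/
lemma integrable_exp_mul_of_summable_moments {P : Measure ℝ} (hP : ∀ᵐ x ∂P, 0 ≤ x) {t : ℝ}
    (ht : 0 ≤ t) (hP_int : ∀ n : ℕ, Integrable (fun x : ℝ ↦ x ^ n) P)
    (hsum : Summable fun n : ℕ ↦ t ^ n / (n.factorial : ℝ) * ∫ x, x ^ n ∂P) :
    Integrable (fun x ↦ Real.exp (t * x)) P := by
  refine ⟨by fun_prop, ?_⟩
  rw [hasFiniteIntegral_iff_ofReal (.of_forall fun x ↦ (Real.exp_pos _).le)]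
  have hnonneg (n : ℕ) : ∀ᵐ x ∂P, 0 ≤ t ^ n / (n.factorial : ℝ) * x ^ n := by
    filter_upwards [hP] with x hx
    positivity
  have hexp : ∀ᵐ x ∂P, ENNReal.ofReal (Real.exp (t * x)) =
      ∑' n : ℕ, ENNReal.ofReal (t ^ n / (n.factorial : ℝ) * x ^ n) := by
    filter_upwards [ae_all_iff.2 hnonneg] with x hx
    have h := NormedSpace.expSeries_div_hasSum_exp (t * x)
    rw [← Real.exp_eq_exp_ℝ] at h
    simp_rw [mul_pow, mul_div_right_comm] at h
    rw [← h.tsum_eq, ENNReal.ofReal_tsum_of_nonneg hx h.summable]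
  rw [lintegral_congr_ae hexp, lintegral_tsum fun n ↦ by fun_prop]
  simp_rw [← integral_const_mul] at hsum
  simp_rw [← fun n ↦ ofReal_integral_eq_lintegral_ofReal ((hP_int n).const_mul _) (hnonneg n)]
  rw [← ENNReal.ofReal_tsum_of_nonneg (fun n ↦ integral_nonneg_of_ae (hnonneg n)) hsum]
  exact ENNReal.ofReal_lt_top

open ProbabilityTheory in
/-- A measure on `[0, ∞)` that integrates `exp (t * x)` for some `t > 0` has exponential moments
around zero. -/
lemma zero_mem_interior_integrableExpSet {P : Measure ℝ} [IsFiniteMeasure P]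
    (hP : ∀ᵐ x ∂P, 0 ≤ x) {t : ℝ} (ht : 0 < t)
    (hP_int : Integrable (fun x ↦ Real.exp (t * x)) P) :
    0 ∈ interior (integrableExpSet id P) := by
  rw [mem_interior_iff_mem_nhds]
  filter_upwards [Iio_mem_nhds ht] with u hu
  have hu_int : Integrable (fun x ↦ Real.exp (u * x)) P := by
    refine hP_int.mono' (by fun_prop) ?_
    filter_upwards [hP] with x hx
    rw [Real.norm_of_nonneg (Real.exp_pos _).le]
    exact Real.exp_le_exp.2 (mul_le_mul_of_nonneg_right (le_of_lt hu) hx)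
  exact hu_int

open ProbabilityTheory Topology in
/-- Finite measures with exponential moments around zero are determined by their moments. -/
theorem MeasureTheory.Measure.ext_of_moments_eq {P Q : Measure ℝ}
    [IsFiniteMeasure P] [IsFiniteMeasure Q]
    (hP : 0 ∈ interior (integrableExpSet id P)) (hQ : 0 ∈ interior (integrableExpSet id Q))
    (h : ∀ n : ℕ, ∫ x, x ^ n ∂P = ∫ x, x ^ n ∂Q) : P = Q := by
  have hmgf : ∀ᶠ t in 𝓝 (0 : ℝ), mgf id P t = mgf id Q t := by
    have h1 := (hasFPowerSeriesAt_mgf hP).eventually_hasSum_sub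
    have h2 := (hasFPowerSeriesAt_mgf hQ).eventually_hasSum_sub
    simp only [id, zero_mul, Real.exp_zero, mul_one, h] at h1 h2
    filter_upwards [h1, h2] with t ht1 ht2 using ht1.unique ht2
  set U : Set ℂ := {z | z.re ∈ interior (integrableExpSet id P) ∩ interior (integrableExpSet id Q)}
  have hU : IsPreconnected U :=
    ((convex_integrableExpSet.interior.inter convex_integrableExpSet.interior).linear_preimage
      Complex.reLm).isPreconnected
  have hfreq : ∃ᶠ z in 𝓝[≠] (0 : ℂ), complexMGF id P z = complexMGF id Q z := by
    have hreal : ∃ᶠ t : ℝ in 𝓝[≠] 0, complexMGF id P t = complexMGF id Q t :=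
      (hmgf.filter_mono nhdsWithin_le_nhds).frequently.mono fun t ht ↦ by
        rw [complexMGF_ofReal, complexMGF_ofReal, ht]
    refine Tendsto.frequently (f := ((↑) : ℝ → ℂ)) ?_ hreal
    refine tendsto_nhdsWithin_iff.2 ⟨?_, ?_⟩
    · exact (Complex.continuous_ofReal.tendsto' 0 0 (by simp)).mono_left nhdsWithin_le_nhds
    · filter_upwards [self_mem_nhdsWithin] with t ht
      simpa using ht
  have heq : Set.EqOn (complexMGF id P) (complexMGF id Q) U :=
    AnalyticOnNhd.eqOn_of_preconnected_of_frequently_eq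
      (analyticOnNhd_complexMGF.mono fun z hz ↦ hz.1)
      (analyticOnNhd_complexMGF.mono fun z hz ↦ hz.2) hU (z₀ := 0)
      (by simpa [U] using ⟨hP, hQ⟩) hfreq
  refine Measure.ext_of_charFun (funext fun t ↦ ?_)
  rw [← complexMGF_id_mul_I, ← complexMGF_id_mul_I]
  exact heq (by simpa [U] using ⟨hP, hQ⟩)

/-- Probability measures on `[0, ∞)` with moments `mutilde` have exponential moments around
zero. -/
lemma zero_mem_interior_integrableExpSet_of_moments {P : Measure ℝ} [IsProbabilityMeasure P]
    (hP : P (Set.Iio 0) = 0) (hmom : ∀ s : ℕ, 1 ≤ s → ∫ x, x ^ s ∂P = mutilde s) :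
    0 ∈ interior (ProbabilityTheory.integrableExpSet id P) := by
  have hP' : ∀ᵐ x ∂P, 0 ≤ x := by
    simpa [ae_iff, ← Set.Iio_def] using hP
  have hP_int (n : ℕ) : Integrable (fun x : ℝ ↦ x ^ n) P := by
    rcases Nat.eq_zero_or_pos n with rfl | hn
    · simp
    · refine not_imp_comm.1 integral_undef ?_
      rw [hmom n hn]
      exact (mutilde_pos n).ne'
  have hle (n : ℕ) : ∫ x, x ^ n ∂P ≤ ((n + 1).factorial : ℝ) := by
    rcases Nat.eq_zero_or_pos n with rfl | hn
    · simp
    · rw [hmom n hn]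
      exact mutilde_le_factorial_succ n
  have hnonneg (n : ℕ) : 0 ≤ ∫ x, x ^ n ∂P :=
    integral_nonneg_of_ae (hP'.mono fun x hx ↦ pow_nonneg hx n)
  refine zero_mem_interior_integrableExpSet hP' (t := 1 / 2) (by norm_num)
    (integrable_exp_mul_of_summable_moments hP' (by norm_num) hP_int ?_)
  have hgeom : Summable fun n : ℕ ↦ ((n : ℝ) + 1) * (1 / 2 : ℝ) ^ n := by
    simp_rw [add_mul, one_mul]
    refine .add ?_ (summable_geometric_of_lt_one (by norm_num) (by norm_num))
    simpa using summable_pow_mul_geometric_of_norm_lt_one 1 (r := (1 / 2 : ℝ)) (by norm_num)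
  refine hgeom.of_nonneg_of_le (fun n ↦ mul_nonneg (by positivity) (hnonneg n)) fun n ↦ ?_
  calc (1 / 2 : ℝ) ^ n / (n.factorial : ℝ) * ∫ x, x ^ n ∂P
      ≤ (1 / 2 : ℝ) ^ n / (n.factorial : ℝ) * ((n + 1).factorial : ℝ) := by
        gcongr
        exact hle n
    _ = _ := by
        rw [Nat.factorial_succ]
        push_cast
        field_simp

theorem stmt16 :
    (∀ s : ℕ, 1 ≤ s → mutilde s ≤ ((2 * s).factorial : ℝ)) ∧
    Tendsto (fun N : ℕ => ∑ s ∈ Finset.Icc 1 N, mutilde s ^ (-(1 / (2 * (s : ℝ)))))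
      atTop atTop ∧
    ∀ P Q : Measure ℝ, IsProbabilityMeasure P → IsProbabilityMeasure Q →
      P (Set.Iio 0) = 0 → Q (Set.Iio 0) = 0 →
      (∀ s : ℕ, 1 ≤ s → ∫ x, x ^ s ∂P = mutilde s) →
      (∀ s : ℕ, 1 ≤ s → ∫ x, x ^ s ∂Q = mutilde s) →
      P = Q := by
  refine ⟨fun s ↦ mutilde_le_factorial_two_mul, tendsto_sum_rpow_of_le_factorial
    (fun s _ ↦ mutilde_pos s) (fun s ↦ mutilde_le_factorial_two_mul), ?_⟩
  intro P Q _ _ hP hQ hPm hQm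
  refine Measure.ext_of_moments_eq (zero_mem_interior_integrableExpSet_of_moments hP hPm)
    (zero_mem_interior_integrableExpSet_of_moments hQ hQm) fun n ↦ ?_
  rcases Nat.eq_zero_or_pos n with rfl | hn
  · simp
  · rw [hPm n hn, hQm n hn]
end
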